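/- arXiv:math/0703273 — 2 statements merged into one kernel-verified Lean document; each statement's English description precedes it below -/
import Mathlib

section
/- Fix an integer n ≥ 1 and σ ∈ {+1, -1}. Let f : ℝ → ℝ be twice continuously differentiable with M_f := Σ_{m=0}^{2} sup_{x ∈ ℝ} e^{x²/8} |f^{(m)}(x)| < ∞, and set M(f) = ∫_{-∞}^{∞} f(x) dx. Define the forcing g(y,s) = (1+s)^{2^{-n} - 3/2} f((y - 2σ s)/√(1+s)) and let u be the Duhamel solution of the inhomogeneous heat equation ∂_t u = ∂_x² u + ∂_x g with u(·,0) = 0, i.e. u(x,t) = ∫_0^t ∫_ℝ ∂_x G_{t-s}(x-y) g(y,s) dy ds with G_τ(x) = (4πτ)^{-1/2} e^{-x²/(4τ)}. Let u_n(x,t) = σ (1+t)^{-1+2^{-(n+1)}} · 2^{-1-2^{-n}} (4π)^{-1/2} f_n(-σ x/√(1+t)). Then there exists C = C(n) > 0, independent of f, such that for all t ≥ 0: ‖u(·,t) − M(f) u_n(·,t)‖_{L²(ℝ)} ≤ C M_f · ln(2+t) · (1+t)^{-3/4} and ‖∂_x u(·,t) − M(f) ∂_x u_n(·,t)‖_{L²(ℝ)}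 ≤ C M_f · ln(2+t) · (1+t)^{-5/4}. -/
open MeasureTheory Real Filter

/-- `f_n(z) = ∫_z^∞ ξ e^{-ξ²/4} (ξ - z)^{2^{-n} - 1} dξ`. -/
noncomputable def fn (n : ℕ) (z : ℝ) : ℝ :=
  ∫ ξ in Set.Ioi z, ξ * Real.exp (-ξ^2/4) * (ξ - z) ^ ((2:ℝ)^(-(n:ℝ)) - 1)

/-- The heat kernel `G_τ(x) = (4πτ)^{-1/2} e^{-x²/(4τ)}`. -/
noncomputable def heatKernel (τ x : ℝ) : ℝ := Real.exp (-x^2/(4*τ)) / Real.sqrt (4*π*τ)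

/-- Duhamel solution of `∂_t u = ∂_x² u + ∂_x g`, `u(·,0)=0`:
`u(x,t) = ∫_0^t ∫_ℝ ∂_x G_{t-s}(x-y) g(y,s) dy ds`. -/
noncomputable def duhamel (g : ℝ → ℝ → ℝ) (x t : ℝ) : ℝ :=
  ∫ s in (0:ℝ)..t, ∫ y : ℝ, deriv (fun x' => heatKernel (t - s) (x' - y)) x * g y s

/-- The forcing profile `g(y,s) = (1+s)^{2^{-n}-3/2} f((y-2σs)/√(1+s))`. -/
noncomputable def forcing (n : ℕ) (σ : ℝ) (f : ℝ → ℝ) (y s : ℝ) : ℝ :=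
  (1 + s) ^ ((2:ℝ)^(-(n:ℝ)) - 3/2) * f ((y - 2*σ*s)/Real.sqrt (1 + s))

/-- `u_n(x,t) = σ (1+t)^{-1+2^{-(n+1)}} 2^{-1-2^{-n}} (4π)^{-1/2} f_n(-σx/√(1+t))`. -/
noncomputable def selfSimU (n : ℕ) (σ : ℝ) (x t : ℝ) : ℝ :=
  σ * (1 + t) ^ (-(1:ℝ) + (2:ℝ)^(-(n:ℝ) - 1)) *
    ((2:ℝ) ^ (-(1:ℝ) - (2:ℝ)^(-(n:ℝ))) / Real.sqrt (4*π)) *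
    fn n (-σ * x / Real.sqrt (1 + t))


/-! ### Minkowski integral inequality in L2 -/

lemma mink_lintegral {S : Type*} [MeasurableSpace S] (μ : Measure S) [SFinite μ]
    (F : S → ℝ → ENNReal) (hF : Measurable (Function.uncurry F)) :
    (∫⁻ x, (∫⁻ s, F s x ∂μ) ^ (2:ℝ)) ^ (1/2:ℝ) ≤ ∫⁻ s, (∫⁻ x, (F s x) ^ (2:ℝ)) ^ (1/2:ℝ) ∂μ := by
  have hFs : ∀ s, Measurable (F s) := fun s => hF.comp measurable_prodMk_left
  have hFx : ∀ x, Measurable (fun s => F s x) := fun x => hF.comp measurable_prodMk_right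
  have key : ∫⁻ x, (∫⁻ s, F s x ∂μ) ^ (2:ℝ)
      ≤ (∫⁻ s, (∫⁻ x, (F s x) ^ (2:ℝ)) ^ (1/2:ℝ) ∂μ) ^ (2:ℝ) := by
    have h1 : ∀ x, (∫⁻ s, F s x ∂μ) ^ (2:ℝ) = ∫⁻ s, ∫⁻ s', F s x * F s' x ∂μ ∂μ := by
      intro x
      have : (2:ℝ) = ((2:ℕ):ℝ) := by norm_num
      rw [this, ENNReal.rpow_natCast, sq, ← lintegral_mul_const _ (hFx x)]
      congr 1; ext s
      rw [lintegral_const_mul _ (hFx x)]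
    have hm3 : Measurable (fun q : (ℝ × S) × S => F q.1.2 q.1.1 * F q.2 q.1.1) := by
      apply Measurable.mul
      · exact hF.comp (by fun_prop : Measurable (fun q : (ℝ × S) × S => (q.1.2, q.1.1)))
      · exact hF.comp (by fun_prop : Measurable (fun q : (ℝ × S) × S => (q.2, q.1.1)))
    have hm2 : Measurable (fun p : ℝ × S => ∫⁻ s', F p.2 p.1 * F s' p.1 ∂μ) :=
      Measurable.lintegral_prod_right' (f := fun q : (ℝ × S) × S => F q.1.2 q.1.1 * F q.2 q.1.1) hm3
    have hmN : Measurable (fun s => (∫⁻ x, (F s x) ^ (2:ℝ)) ^ (1/2:ℝ)) := by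
      apply Measurable.pow_const
      exact Measurable.lintegral_prod_right' (f := fun q : S × ℝ => F q.1 q.2 ^ (2:ℝ))
        (hF.pow_const _)
    calc ∫⁻ x, (∫⁻ s, F s x ∂μ) ^ (2:ℝ) = ∫⁻ x, ∫⁻ s, ∫⁻ s', F s x * F s' x ∂μ ∂μ := by
          simp_rw [h1]
      _ = ∫⁻ s, ∫⁻ x, ∫⁻ s', F s x * F s' x ∂μ ∂volume ∂μ := by
          rw [lintegral_lintegral_swap hm2.aemeasurable]
      _ = ∫⁻ s, ∫⁻ s', ∫⁻ x, F s x * F s' x ∂volume ∂μ ∂μ := by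
          congr 1; ext s
          rw [lintegral_lintegral_swap]
          apply Measurable.aemeasurable
          exact ((hFs s).comp measurable_fst).mul
            (hF.comp (by fun_prop : Measurable (fun q : ℝ × S => (q.2, q.1))))
      _ ≤ ∫⁻ s, ∫⁻ s', (∫⁻ x, (F s x) ^ (2:ℝ)) ^ (1/2:ℝ) * (∫⁻ x, (F s' x) ^ (2:ℝ)) ^ (1/2:ℝ) ∂μ ∂μ := by
          apply lintegral_mono; intro s; apply lintegral_mono; intro s'
          exact ENNReal.lintegral_mul_le_Lp_mul_Lq volume (Real.HolderConjugate.two_two)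
            (hFs s).aemeasurable (hFs s').aemeasurable
      _ = (∫⁻ s, (∫⁻ x, (F s x) ^ (2:ℝ)) ^ (1/2:ℝ) ∂μ) ^ (2:ℝ) := by
          have : (2:ℝ) = ((2:ℕ):ℝ) := by norm_num
          rw [this, ENNReal.rpow_natCast, sq, ← lintegral_mul_const _ (by simpa using hmN)]
          congr 1; ext s
          rw [lintegral_const_mul _ (by simpa using hmN)]
  calc _ ≤ ((∫⁻ s, (∫⁻ x, (F s x) ^ (2:ℝ)) ^ (1/2:ℝ) ∂μ) ^ (2:ℝ)) ^ (1/2:ℝ) := by gcongr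
    _ = _ := by rw [← ENNReal.rpow_mul]; norm_num

lemma eLpNorm_two (f : ℝ → ℝ) : eLpNorm f 2 volume = (∫⁻ x, ‖f x‖ₑ ^ (2:ℝ)) ^ (1/2:ℝ) := by
  rw [eLpNorm_eq_lintegral_rpow_enorm_toReal (by norm_num) (by norm_num)]; simp

lemma mink {S : Type*} [MeasurableSpace S] (μ : Measure S) [SFinite μ]
    (F : S → ℝ → ℝ) (hF : Measurable (Function.uncurry F)) :
    eLpNorm (fun x => ∫ s, F s x ∂μ) 2 volume ≤ ∫⁻ s, eLpNorm (F s) 2 volume ∂μ := by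
  simp_rw [eLpNorm_two]
  refine le_trans ?_ (mink_lintegral μ (fun s x => ‖F s x‖ₑ) hF.enorm)
  gcongr with x
  exact enorm_integral_le_lintegral_enorm _

/-! ### Gaussian-bounded functions -/

/-- continuous with Gaussian bound -/
def Gd (K : ℝ) (p : ℝ → ℝ) : Prop := Continuous p ∧ ∀ x, |p x| ≤ K * exp (-x^2/16)

lemma Gd.nonneg {K : ℝ} {p : ℝ → ℝ} (h : Gd K p) : 0 ≤ K := by
  have := (abs_nonneg _).trans (h.2 0)
  simpa using this

lemma Gd.le {K : ℝ} {p : ℝ → ℝ} (h : Gd K p) (x : ℝ) : |p x| ≤ K := by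
  refine (h.2 x).trans ?_
  have : exp (-x^2/16) ≤ 1 := by rw [exp_le_one_iff]; nlinarith [sq_nonneg x]
  nlinarith [h.nonneg]

lemma Gd.mono {K L : ℝ} {p : ℝ → ℝ} (h : Gd K p) (hKL : K ≤ L) : Gd L p :=
  ⟨h.1, fun x => (h.2 x).trans (by gcongr)⟩

lemma Gd.add {K L : ℝ} {p q : ℝ → ℝ} (h : Gd K p) (h' : Gd L q) : Gd (K + L) (fun x => p x + q x) :=
  ⟨h.1.add h'.1, fun x => by
    have := abs_add_le (p x) (q x)
    nlinarith [h.2 x, h'.2 x]⟩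

lemma Gd.smul {K : ℝ} {p : ℝ → ℝ} (h : Gd K p) (c : ℝ) : Gd (|c| * K) (fun x => c * p x) :=
  ⟨h.1.const_mul c, fun x => by
    rw [abs_mul, mul_assoc]
    exact mul_le_mul_of_nonneg_left (h.2 x) (abs_nonneg c)⟩

lemma integrable_g16 : Integrable (fun x : ℝ => exp (-x^2/16)) := by
  have := integrable_exp_neg_mul_sq (b := 1/16) (by norm_num)
  refine this.congr (ae_of_all _ fun x => ?_)
  simp only; congr 1; ring

lemma Gd.integrable {K : ℝ} {p : ℝ → ℝ} (h : Gd K p) : Integrable p :=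
  (integrable_g16.const_mul K).mono' h.1.aestronglyMeasurable (ae_of_all _ h.2)

lemma gd_l1 : ∃ c : ℝ, 0 < c ∧ ∀ K p, Gd K p → ∫⁻ x, ‖p x‖ₑ ≤ ENNReal.ofReal (c * K) := by
  refine ⟨(∫ x : ℝ, exp (-x^2/16)) + 1, ?_, ?_⟩
  · have : 0 ≤ ∫ x : ℝ, exp (-x^2/16) := integral_nonneg fun x => (exp_pos _).le
    linarith
  · intro K p h
    have h1 : ∫⁻ x, ‖p x‖ₑ = ENNReal.ofReal (∫ x, ‖p x‖) := by
      rw [ofReal_integral_norm_eq_lintegral_enorm h.integrable]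
    rw [h1]
    apply ENNReal.ofReal_le_ofReal
    calc ∫ x, ‖p x‖ ≤ ∫ x, K * exp (-x^2/16) :=
          integral_mono h.integrable.norm (integrable_g16.const_mul K) h.2
      _ = K * ∫ x : ℝ, exp (-x^2/16) := integral_const_mul _ _
      _ ≤ _ := by nlinarith [h.nonneg]

lemma gd_l2 : ∃ c : ℝ, 0 < c ∧ ∀ K p, Gd K p → ∀ l b : ℝ, 0 < l →
    eLpNorm (fun x => p ((x - b) / l)) 2 volume ≤ ENNReal.ofReal (c * K * l ^ (1/2:ℝ)) := by
  refine ⟨(√(π / (1/8))) ^ (1/2:ℝ), by positivity, ?_⟩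
  intro K p h l b hl
  have hK := h.nonneg
  rw [eLpNorm_two]
  have hint : Integrable (fun x : ℝ => (K * exp (-((x-b)/l)^2/16))^2) := by
    have := (integrable_exp_neg_mul_sq (b := 1/8) (by norm_num)).const_mul (K^2)
    have := (this.comp_div hl.ne').comp_sub_right b
    refine this.congr (ae_of_all _ fun x => ?_)
    simp only
    rw [mul_pow, ← exp_nat_mul]; congr 2; push_cast; ring
  have h1 : ∫⁻ x, ‖p ((x - b) / l)‖ₑ ^ (2:ℝ) ≤ ENNReal.ofReal (K^2 * (l * √(π / (1/8)))) := by
    calc ∫⁻ x, ‖p ((x - b) / l)‖ₑ ^ (2:ℝ)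
        ≤ ∫⁻ x, ENNReal.ofReal ((K * exp (-((x-b)/l)^2/16))^2) := by
          apply lintegral_mono; intro x
          simp only
          rw [← ofReal_norm, ENNReal.ofReal_rpow_of_nonneg (norm_nonneg _) (by norm_num)]
          apply ENNReal.ofReal_le_ofReal
          rw [Real.rpow_two]
          gcongr
          exact h.2 _
      _ = ENNReal.ofReal (∫ x, (K * exp (-((x-b)/l)^2/16))^2) := by
          rw [ofReal_integral_eq_lintegral_ofReal hint (ae_of_all _ fun x => by positivity)]
      _ = _ := by
          congr 1
          have e : ∀ x, (K * exp (-((x-b)/l)^2/16))^2 = (fun y : ℝ => K^2 * exp (-(1/8) * (y/l)^2)) (x - b) := by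
            intro x; simp only
            rw [mul_pow, ← exp_nat_mul]; congr 2; push_cast; ring
          simp_rw [e]
          rw [integral_sub_right_eq_self (fun y : ℝ => K^2 * exp (-(1/8) * (y/l)^2)), integral_const_mul,
            Measure.integral_comp_div (fun y : ℝ => exp (-(1/8) * y^2)), integral_gaussian, abs_of_pos hl]
          simp
  calc _ ≤ (ENNReal.ofReal (K^2 * (l * √(π / (1/8))))) ^ (1/2:ℝ) := by gcongr
    _ = _ := by
      rw [ENNReal.ofReal_rpow_of_nonneg (by positivity) (by norm_num)]
      congr 1
      rw [Real.mul_rpow (by positivity) (by positivity), Real.mul_rpow (by positivity) (by positivity),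
        ← Real.rpow_natCast, ← Real.rpow_mul hK]
      norm_num
      ring

lemma gd_young : ∃ c : ℝ, 0 < c ∧ ∀ A p B q, Gd A p → Gd B q → ∀ l b : ℝ, 0 < l →
    eLpNorm (fun x => ∫ r, p r * q ((x - b * r) / l)) 2 volume
      ≤ ENNReal.ofReal (c * A * B * l ^ (1/2:ℝ)) := by
  obtain ⟨c1, hc1, h1⟩ := gd_l1
  obtain ⟨c2, hc2, h2⟩ := gd_l2
  refine ⟨c1 * c2, by positivity, ?_⟩
  intro A p B q hp hq l b hl
  have hA := hp.nonneg
  have hB := hq.nonneg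
  have := hp.1.measurable
  have := hq.1.measurable
  refine (mink volume (fun r x => p r * q ((x - b * r) / l)) (by
    unfold Function.uncurry; fun_prop)).trans ?_
  calc ∫⁻ r, eLpNorm (fun x => p r * q ((x - b * r) / l)) 2 volume
      ≤ ∫⁻ r, ‖p r‖ₑ * ENNReal.ofReal (c2 * B * l ^ (1/2:ℝ)) := by
        apply lintegral_mono; intro r
        have e := eLpNorm_const_smul (p r) (fun x => q ((x - b * r) / l)) 2 volume
        have e' : (p r • fun x => q ((x - b * r) / l)) = fun x => p r * q ((x - b * r) / l) := rfl
        rw [e'] at e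
        simp only
        rw [e]
        gcongr
        exact h2 B q hq l (b * r) hl
    _ = (∫⁻ r, ‖p r‖ₑ) * ENNReal.ofReal (c2 * B * l ^ (1/2:ℝ)) := by
        rw [lintegral_mul_const _ (by fun_prop)]
    _ ≤ ENNReal.ofReal (c1 * A) * ENNReal.ofReal (c2 * B * l ^ (1/2:ℝ)) := by
        gcongr; exact h1 A p hp
    _ = _ := by
        rw [← ENNReal.ofReal_mul (by positivity)]; congr 1; ring

/-! ### derivatives of the Gaussian -/

noncomputable def gpoly : ℕ → Polynomial ℝ
  | 0 => 1
  | n+1 => Polynomial.derivative (gpoly n) - Polynomial.C (1/2) * Polynomial.X * gpoly n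

noncomputable def gk (j : ℕ) (x : ℝ) : ℝ := (gpoly j).eval x * (exp (-x^2/4) / √(4*π))

lemma gk_zero (x : ℝ) : gk 0 x = exp (-x^2/4) / √(4*π) := by simp [gk, gpoly]
lemma gk_one (x : ℝ) : gk 1 x = -(x/2) * (exp (-x^2/4) / √(4*π)) := by
  have : (gpoly 1).eval x = -(x/2) := by
    simp [gpoly]; ring
  rw [gk, this]

lemma hasDerivAt_gk (j : ℕ) (x : ℝ) : HasDerivAt (gk j) (gk (j+1) x) x := by
  have h1 := (gpoly j).hasDerivAt x
  have h2 : HasDerivAt (fun x : ℝ => exp (-x^2/4) / √(4*π)) (exp (-x^2/4) * (-(2*x)/4) / √(4*π)) x := by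
    have := (((hasDerivAt_pow 2 x).neg.div_const 4).exp).div_const (√(4*π))
    refine this.congr_deriv ?_
    simp only [Pi.neg_apply]; norm_num
  refine (h1.mul h2).congr_deriv ?_
  rw [gk, gpoly, Polynomial.eval_sub, Polynomial.eval_mul, Polynomial.eval_mul, Polynomial.eval_C, Polynomial.eval_X]
  ring

lemma gk_cont (j : ℕ) : Continuous (gk j) :=
  continuous_iff_continuousAt.2 fun x => (hasDerivAt_gk j x).continuousAt

lemma poly_bound (P : Polynomial ℝ) : ∃ C : ℝ, 0 ≤ C ∧ ∀ x, |P.eval x| ≤ C * exp (x^2/8) := by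
  induction P using Polynomial.induction_on' with
  | add p q hp hq =>
    obtain ⟨C, hC, h⟩ := hp
    obtain ⟨D, hD, h'⟩ := hq
    refine ⟨C + D, by positivity, fun x => ?_⟩
    rw [Polynomial.eval_add, add_mul]
    exact (abs_add_le _ _).trans (add_le_add (h x) (h' x))
  | monomial n a =>
    refine ⟨|a| * (1 + 8^n * n.factorial), by positivity, fun x => ?_⟩
    rw [Polynomial.eval_monomial, abs_mul, mul_assoc, abs_pow]
    gcongr
    have h1 := Real.pow_div_factorial_le_exp (x^2/8) (by positivity) n
    rw [div_le_iff₀ (by positivity)] at h1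
    have h2 : |x|^n ≤ 1 + (x^2)^n := by
      have : (x^2)^n = (|x|^n)^2 := by rw [← sq_abs]; ring
      rw [this]; nlinarith [sq_nonneg (|x|^n - 1), sq_nonneg (|x|^n)]
    have h3 : (x^2)^n = 8^n * (x^2/8)^n := by rw [← mul_pow]; congr 1; ring
    have h4 : 1 ≤ exp (x^2/8) := by apply Real.one_le_exp; positivity
    have h5 : (x^2)^n ≤ 8^n * (exp (x^2/8) * n.factorial) := by rw [h3]; gcongr
    nlinarith

lemma gk_gd (j : ℕ) : ∃ C : ℝ, Gd C (gk j) := by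
  obtain ⟨C, hC, h⟩ := poly_bound (gpoly j)
  refine ⟨C / √(4*π), gk_cont j, fun x => ?_⟩
  rw [gk, abs_mul, abs_of_pos (a := exp (-x^2/4) / √(4*π)) (by positivity)]
  calc _ ≤ C * exp (x^2/8) * (exp (-x^2/4) / √(4*π)) := by gcongr; exact h x
    _ = C / √(4*π) * (exp (x^2/8) * exp (-x^2/4)) := by ring
    _ ≤ _ := by
      rw [← exp_add]
      gcongr
      nlinarith [sq_nonneg x]

/-- smoothing operator -/
noncomputable def U (j : ℕ) (a l : ℝ) (χ : ℝ → ℝ) (x : ℝ) : ℝ := ∫ ρ, gk j ρ * χ ((x - a * ρ) / l)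


lemma eLpNorm_shift (f : ℝ → ℝ) (b : ℝ) :
    eLpNorm (fun x => f (x - b)) 2 volume = eLpNorm f 2 volume := by
  rw [eLpNorm_two, eLpNorm_two, lintegral_sub_right_eq_self (fun x => ‖f x‖ₑ ^ (2:ℝ))]

lemma U_swap (j : ℕ) (a l : ℝ) (ha : 0 < a) (hl : 0 < l) (χ : ℝ → ℝ) (x : ℝ) :
    U j a l χ x = (l / a) * ∫ r, χ r * gk j ((x - l * r) / a) := by
  have h1 : ∫ r, χ r * gk j ((x - l * r) / a)
      = ∫ r, (fun ρ => χ ((x - a * ρ)/l) * gk j ρ) (x/a - r * (l/a)) := by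
    congr 1; ext r
    simp only
    congr 2
    · field_simp; ring
    · field_simp
  have h2 : ∫ r, (fun ρ => χ ((x - a * ρ)/l) * gk j ρ) (x/a - r * (l/a))
    = |(l/a)⁻¹| • ∫ y, (fun y => (fun ρ => χ ((x - a * ρ)/l) * gk j ρ) (x/a - y)) y := by
    rw [← Measure.integral_comp_mul_right]
  rw [h1, h2, integral_sub_left_eq_self (fun ρ => χ ((x - a * ρ)/l) * gk j ρ), abs_of_pos (by positivity),
    smul_eq_mul, ← mul_assoc, mul_inv_cancel₀ (by positivity), one_mul, U]
  congr 1; ext ρ; ring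

lemma Gd.mul_bdd {K : ℝ} {p : ℝ → ℝ} (h : Gd K p) (q : ℝ → ℝ) (hq : Continuous q) (C : ℝ)
    (hC : ∀ x, |q x| ≤ C) : Integrable (fun x => p x * q x) := by
  have := h.integrable.bdd_mul (c := C) hq.aestronglyMeasurable (ae_of_all _ hC)
  simpa [mul_comm] using this

lemma U_integrable {K : ℝ} {χ : ℝ → ℝ} (h : Gd K χ) (j : ℕ) (a l x : ℝ) :
    Integrable (fun ρ => gk j ρ * χ ((x - a * ρ) / l)) := by
  obtain ⟨C, hC⟩ := gk_gd j
  exact hC.mul_bdd _ (h.1.comp (by fun_prop)) K (fun ρ => h.le _)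

lemma U_ibp {K : ℝ} {X X' : ℝ → ℝ} (h : Gd K X) (h' : Gd K X') (hd : ∀ x, HasDerivAt X (X' x) x)
    (j : ℕ) (a l : ℝ) (ha : 0 < a) (hl : 0 < l) (x : ℝ) :
    U j a l X' x = (l / a) * U (j+1) a l X x := by
  have hv : ∀ ρ, HasDerivAt (fun ρ => X ((x - a * ρ) / l)) (-(a/l) * X' ((x - a * ρ) / l)) ρ := by
    intro ρ
    have h1 : HasDerivAt (fun ρ => (x - a * ρ) / l) (-(a/l)) ρ := by
      have := (((hasDerivAt_id ρ).const_mul a).const_sub x).div_const l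
      refine this.congr_deriv ?_
      ring
    have := (hd ((x - a * ρ) / l)).comp ρ h1
    refine this.congr_deriv ?_
    ring
  have := integral_mul_deriv_eq_deriv_mul_of_integrable
    (u := gk j) (u' := gk (j+1)) (v := fun ρ => X ((x - a * ρ) / l))
    (v' := fun ρ => -(a/l) * X' ((x - a * ρ) / l))
    (fun ρ _ => hasDerivAt_gk j ρ) (fun ρ _ => hv ρ) ?_ (U_integrable h (j+1) a l x) (U_integrable h j a l x)
  · have e : ∫ ρ, gk j ρ * (-(a/l) * X' ((x - a * ρ) / l)) = -(a/l) * U j a l X' x := by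
      rw [U, ← integral_const_mul]; congr 1; ext ρ; ring
    rw [e] at this
    have e2 : U j a l X' x = (l / a) * ((a / l) * U j a l X' x) := by field_simp
    rw [e2]; congr 1
    have t2 : U (j+1) a l X x = ∫ ρ, gk (j+1) ρ * X ((x - a * ρ) / l) := rfl
    linarith
  · refine ((U_integrable h' j a l x).const_mul (-(a/l))).congr (ae_of_all _ fun ρ => ?_)
    simp only [Pi.mul_apply]; ring

/-- derivative chain of Gaussian-bounded functions -/
structure Chain (K : ℝ) (k : ℕ) (X : ℕ → ℝ → ℝ) : Prop where
  gd : ∀ i ≤ k, Gd K (X i)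
  der : ∀ i < k, ∀ x, HasDerivAt (X i) (X (i+1) x) x

lemma U_iter {K : ℝ} {k : ℕ} {X : ℕ → ℝ → ℝ} (h : Chain K k X) (a l : ℝ) (ha : 0 < a) (hl : 0 < l)
    (x : ℝ) : ∀ m ≤ k, ∀ j, U j a l (X m) x = (l / a)^m * U (j+m) a l (X 0) x := by
  intro m
  induction m with
  | zero => intro _ j; simp
  | succ m ih =>
    intro hm j
    rw [U_ibp (h.gd m (by omega)) (h.gd (m+1) hm) (h.der m (by omega)) j a l ha hl x,
      ih (by omega) (j+1), pow_succ, show j + 1 + m = j + (m+1) by ring]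
    ring

lemma U_l2 (j : ℕ) : ∃ c : ℝ, 0 < c ∧ ∀ K χ, Gd K χ → ∀ a l b, 0 < l →
    eLpNorm (fun x => U j a l χ (x - b)) 2 volume ≤ ENNReal.ofReal (c * K * l ^ (1/2:ℝ)) := by
  obtain ⟨c, hc, h⟩ := gd_young
  obtain ⟨C, hC⟩ := gk_gd j
  have hC' := hC.mono (show C ≤ C + 1 by linarith)
  have := hC.nonneg
  refine ⟨c * (C + 1), by positivity, fun K χ hχ a l b hl => ?_⟩
  rw [eLpNorm_shift]
  exact h (C+1) (gk j) K χ hC' hχ l a hl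

lemma U_l2' (j : ℕ) : ∃ c : ℝ, 0 < c ∧ ∀ K χ, Gd K χ → ∀ a l b, 0 < a → 0 < l →
    eLpNorm (fun x => U j a l χ (x - b)) 2 volume ≤ ENNReal.ofReal (c * K * (l / a) * a ^ (1/2:ℝ)) := by
  obtain ⟨c, hc, h⟩ := gd_young
  obtain ⟨C, hC⟩ := gk_gd j
  have hC' := hC.mono (show C ≤ C + 1 by linarith)
  have := hC.nonneg
  refine ⟨c * (C + 1), by positivity, fun K χ hχ a l b ha hl => ?_⟩
  rw [eLpNorm_shift]
  have e := h K χ (C+1) (gk j) hχ hC' a l ha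
  have e2 : U j a l χ = (l/a) • (fun x => ∫ r, χ r * gk j ((x - l * r) / a)) := by
    ext x; rw [U_swap j a l ha hl]; rfl
  rw [e2, eLpNorm_const_smul, ← ofReal_norm, Real.norm_of_nonneg (by positivity)]
  calc _ ≤ ENNReal.ofReal (l/a) * ENNReal.ofReal (c * K * (C+1) * a ^ (1/2:ℝ)) := by gcongr
    _ = _ := by rw [← ENNReal.ofReal_mul (by positivity)]; congr 1; ring

lemma smoothing (j k : ℕ) : ∃ c : ℝ, 0 < c ∧ ∀ K X, Chain K k X → ∀ a l b T, 0 ≤ a → 0 < l →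
    a^2 + l^2 = T →
    eLpNorm (fun x => U j a l (X k) (x - b)) 2 volume
      ≤ ENNReal.ofReal (c * K * l ^ (k+1) * T ^ (-(1/4 + k/2 : ℝ))) := by
  obtain ⟨c1, hc1, h1⟩ := U_l2 j
  obtain ⟨c2, hc2, h2⟩ := U_l2' (j+k)
  refine ⟨(c1 + c2) * 2 ^ (1/4 + k/2 : ℝ), by positivity, ?_⟩
  intro K X hX a l b T ha hl hT
  have hK := (hX.gd 0 (by omega)).nonneg
  have hTpos : 0 < T := by rw [← hT]; positivity
  -- general inequality
  have gen : ∀ m : ℝ, 0 < m → T ≤ 2 * m^2 → m ^ (-(k + 1/2 : ℝ)) ≤ 2 ^ (1/4 + k/2 : ℝ) * T ^ (-(1/4 + k/2 : ℝ)) := by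
    intro m hm hTm
    have e1 : m ^ (-(k + 1/2 : ℝ)) = (m^2) ^ (-(1/4 + k/2 : ℝ)) := by
      rw [← Real.rpow_natCast, ← Real.rpow_mul hm.le]; congr 1; push_cast; ring
    have e2 : (2:ℝ) ^ (1/4 + k/2 : ℝ) * T ^ (-(1/4 + k/2 : ℝ)) = (T/2) ^ (-(1/4 + k/2 : ℝ)) := by
      rw [Real.div_rpow hTpos.le (by norm_num), Real.rpow_neg (by norm_num : (0:ℝ) ≤ 2)]
      field_simp
    rw [e1, e2]
    apply Real.rpow_le_rpow_of_nonpos (by positivity) (by linarith)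
    have : (0:ℝ) ≤ 1/4 + k/2 := by positivity
    linarith
  by_cases hal : a ≤ l
  · refine (h1 K (X k) (hX.gd k le_rfl) a l b hl).trans ?_
    apply ENNReal.ofReal_le_ofReal
    have := gen l hl (by nlinarith)
    have e : l ^ (1/2:ℝ) = l^(k+1) * l ^ (-(k + 1/2 : ℝ)) := by
      rw [← Real.rpow_natCast, ← Real.rpow_add hl]; congr 1; push_cast; ring
    rw [e]
    calc c1 * K * (l^(k+1) * l ^ (-(k + 1/2 : ℝ)))
        ≤ (c1 + c2) * K * (l^(k+1) * (2 ^ (1/4 + k/2 : ℝ) * T ^ (-(1/4 + k/2 : ℝ)))) := by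
          gcongr; linarith
      _ = _ := by ring
  · push Not at hal
    have ha0 : 0 < a := hl.trans hal
    have e : (fun x => U j a l (X k) (x - b)) = ((l/a)^k) • (fun x => U (j+k) a l (X 0) (x - b)) := by
      ext x; rw [U_iter hX a l ha0 hl _ k le_rfl j]; rfl
    rw [e, eLpNorm_const_smul, ← ofReal_norm, Real.norm_of_nonneg (by positivity)]
    have := gen a ha0 (by nlinarith)
    calc _ ≤ ENNReal.ofReal ((l/a)^k) * ENNReal.ofReal (c2 * K * (l / a) * a ^ (1/2:ℝ)) := by
          gcongr; exact h2 K (X 0) (hX.gd 0 (by omega)) a l b ha0 hl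
      _ = ENNReal.ofReal (c2 * K * (l^(k+1) * a ^ (-(k + 1/2 : ℝ)))) := by
          rw [← ENNReal.ofReal_mul (by positivity)]; congr 1
          have : a ^ (-(k + 1/2 : ℝ)) = a ^ (1/2:ℝ) / a^(k+1) := by
            rw [← Real.rpow_natCast, ← Real.rpow_sub ha0]; congr 1; push_cast; ring
          rw [this, div_pow]
          field_simp
          ring
      _ ≤ _ := by
          apply ENNReal.ofReal_le_ofReal
          calc _ ≤ (c1 + c2) * K * (l^(k+1) * (2 ^ (1/4 + k/2 : ℝ) * T ^ (-(1/4 + k/2 : ℝ)))) := by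
                gcongr; linarith
            _ = _ := by ring


lemma U_bound (j : ℕ) : ∃ c : ℝ, 0 < c ∧ ∀ K χ, Gd K χ → ∀ a l x, |U j a l χ x| ≤ c * K := by
  obtain ⟨C, hC⟩ := gk_gd j
  refine ⟨(∫ ρ, |gk j ρ|) + 1, ?_, fun K χ hχ a l x => ?_⟩
  · have : 0 ≤ ∫ ρ, |gk j ρ| := integral_nonneg fun x => abs_nonneg _
    linarith
  · have hK := hχ.nonneg
    calc |U j a l χ x| ≤ ∫ ρ, |gk j ρ * χ ((x - a * ρ) / l)| := abs_integral_le_integral_abs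
      _ ≤ ∫ ρ, |gk j ρ| * K := by
          apply integral_mono (U_integrable hχ j a l x).abs (hC.integrable.abs.mul_const K)
          intro ρ
          simp only [abs_mul]
          gcongr
          exact hχ.le _
      _ = (∫ ρ, |gk j ρ|) * K := integral_mul_const _ _
      _ ≤ _ := by nlinarith

lemma U_meas (j : ℕ) (χ : ℝ → ℝ) (hχ : Continuous χ) (a l b : ℝ → ℝ) (ha : Measurable a) (hl : Measurable l)
    (hb : Measurable b) :
    Measurable (Function.uncurry fun s x => U j (a s) (l s) χ (x - b s)) := by
  have hg := (gk_cont j).measurable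
  have hm := hχ.measurable
  have : StronglyMeasurable (Function.uncurry (fun (q : ℝ × ℝ) (ρ : ℝ) =>
      gk j ρ * χ ((q.2 - b q.1 - a q.1 * ρ) / l q.1))) := by
    apply Measurable.stronglyMeasurable
    unfold Function.uncurry
    fun_prop
  exact (this.integral_prod_right (ν := volume)).measurable

lemma U_meas_s (j : ℕ) (χ : ℝ → ℝ) (hχ : Continuous χ) (a l b : ℝ → ℝ) (ha : Measurable a) (hl : Measurable l)
    (hb : Measurable b) (x : ℝ) :
    Measurable (fun s => U j (a s) (l s) χ (x - b s)) :=
  (U_meas j χ hχ a l b ha hl hb).comp measurable_prodMk_right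

lemma U_contOn {K : ℝ} {χ : ℝ → ℝ} (h : Gd K χ) (j : ℕ) (σ t x : ℝ) :
    ContinuousOn (fun s => U j (√(t-s)) (√(1+s)) χ (x - 2*σ*s)) (Set.Icc 0 t) := by
  obtain ⟨C, hC⟩ := gk_gd j
  unfold U
  have hc := h.1
  have hg := gk_cont j
  apply continuousOn_of_dominated (bound := fun ρ => |gk j ρ| * K)
  · intro s _
    exact (U_integrable h j _ _ _).aestronglyMeasurable
  · intro s _
    refine ae_of_all _ fun ρ => ?_
    rw [Real.norm_eq_abs, abs_mul]
    gcongr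
    exact h.le _
  · exact hC.integrable.abs.mul_const K
  · refine ae_of_all _ fun ρ => ?_
    apply ContinuousOn.mul continuousOn_const
    apply hc.comp_continuousOn
    apply ContinuousOn.div
    · fun_prop
    · fun_prop
    · intro s hs
      have : 0 < 1 + s := by linarith [hs.1]
      positivity

lemma U_deriv_s {K : ℝ} {χ χ' : ℝ → ℝ} (h : Gd K χ) (h' : Gd K χ') (hy : Gd K (fun y => y * χ' y))
    (hd : ∀ x, HasDerivAt χ (χ' x) x) (σ t x s : ℝ) (hs : 0 < s) (hst : s < t) :
    HasDerivAt (fun s => U 0 (√(t-s)) (√(1+s)) χ (x - 2*σ*s))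
      (-(2*σ) * (√(1+s))⁻¹ * U 0 (√(t-s)) (√(1+s)) χ' (x - 2*σ*s)
        - (√(1+s))⁻¹ * (√(t-s))⁻¹ * U 1 (√(t-s)) (√(1+s)) χ' (x - 2*σ*s)
        - (1/2) * (1+s)⁻¹ * U 0 (√(t-s)) (√(1+s)) (fun y => y * χ' y) (x - 2*σ*s)) s := by
  have hK := h.nonneg
  obtain ⟨C0, hC0⟩ := gk_gd 0
  obtain ⟨C1, hC1⟩ := gk_gd 1
  -- derivative of the argument
  set arg : ℝ → ℝ → ℝ := fun s ρ => (x - 2*σ*s - √(t-s) * ρ) / √(1+s) with harg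
  have hargd : ∀ ρ, ∀ s, 0 < s → s < t → HasDerivAt (fun s => arg s ρ)
      (-(2*σ) * (√(1+s))⁻¹ + (√(1+s))⁻¹ * (√(t-s))⁻¹ * (ρ/2) - (1/2) * (1+s)⁻¹ * arg s ρ) s := by
    intro ρ s hs hst
    have p1 : 0 < 1 + s := by linarith
    have p2 : 0 < t - s := by linarith
    have d1 : HasDerivAt (fun s => √(t-s)) (-1 / (2 * √(t-s))) s :=
      ((hasDerivAt_id s).const_sub t).sqrt p2.ne'
    have d2 : HasDerivAt (fun s => √(1+s)) (1 / (2 * √(1+s))) s :=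
      ((hasDerivAt_id s).const_add 1).sqrt p1.ne'
    have d3 : HasDerivAt (fun s => x - 2*σ*s - √(t-s) * ρ) (-(2*σ) - (-1 / (2 * √(t-s))) * ρ) s := by
      have := (((hasDerivAt_id s).const_mul (2*σ)).const_sub x).sub (d1.mul_const ρ)
      refine this.congr_deriv ?_
      simp
    have hsq : √(1+s) ≠ 0 := by positivity
    have hsq' : √(t-s) ≠ 0 := by positivity
    have := d3.div d2 hsq
    refine this.congr_deriv ?_
    simp only [harg]
    have e : (1 + s) = √(1+s)^2 := (Real.sq_sqrt p1.le).symm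
    have e' : (1 + s)⁻¹ = (√(1+s)^2)⁻¹ := by rw [← e]
    rw [e']
    field_simp
    ring
  have main := hasDerivAt_integral_of_dominated_loc_of_deriv_le (μ := volume) (𝕜 := ℝ)
    (F := fun s ρ => gk 0 ρ * χ (arg s ρ))
    (F' := fun s ρ => gk 0 ρ * (χ' (arg s ρ) *
      (-(2*σ) * (√(1+s))⁻¹ + (√(1+s))⁻¹ * (√(t-s))⁻¹ * (ρ/2) - (1/2) * (1+s)⁻¹ * arg s ρ)))
    (bound := fun ρ => |gk 0 ρ| * (|2*σ| * K + 1/2 * K) + |gk 1 ρ| * (K * (√((t-s)/2))⁻¹))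
    (x₀ := s) (s := Set.Ioo (s/2) ((s+t)/2)) (Ioo_mem_nhds (by linarith) (by linarith)) ?_ ?_ ?_ ?_ ?_ ?_
  · refine main.2.congr_deriv ?_
    have e : ∀ ρ, gk 0 ρ * (χ' (arg s ρ) *
      (-(2*σ) * (√(1+s))⁻¹ + (√(1+s))⁻¹ * (√(t-s))⁻¹ * (ρ/2) - (1/2) * (1+s)⁻¹ * arg s ρ))
      = -(2*σ) * (√(1+s))⁻¹ * (gk 0 ρ * χ' (arg s ρ)) - (√(1+s))⁻¹ * (√(t-s))⁻¹ * (gk 1 ρ * χ' (arg s ρ))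
        - (1/2) * (1+s)⁻¹ * (gk 0 ρ * (arg s ρ * χ' (arg s ρ))) := by
      intro ρ
      rw [gk_one, gk_zero]; ring
    simp_rw [e]
    have i1 : Integrable (fun ρ => -(2*σ) * (√(1+s))⁻¹ * (gk 0 ρ * χ' (arg s ρ))) := (U_integrable h' 0 (√(t-s)) (√(1+s)) (x - 2*σ*s)).const_mul (-(2*σ) * (√(1+s))⁻¹)
    have i2 : Integrable (fun ρ => (√(1+s))⁻¹ * (√(t-s))⁻¹ * (gk 1 ρ * χ' (arg s ρ))) := (U_integrable h' 1 (√(t-s)) (√(1+s)) (x - 2*σ*s)).const_mul ((√(1+s))⁻¹ * (√(t-s))⁻¹)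
    have i3 : Integrable (fun ρ => (1/2) * (1+s)⁻¹ * (gk 0 ρ * (arg s ρ * χ' (arg s ρ)))) := (U_integrable hy 0 (√(t-s)) (√(1+s)) (x - 2*σ*s)).const_mul ((1/2) * (1+s)⁻¹)
    have i12 : Integrable (fun ρ => -(2*σ) * (√(1+s))⁻¹ * (gk 0 ρ * χ' (arg s ρ))
      - (√(1+s))⁻¹ * (√(t-s))⁻¹ * (gk 1 ρ * χ' (arg s ρ))) := i1.sub i2
    rw [integral_sub i12 i3, integral_sub i1 i2, integral_const_mul, integral_const_mul, integral_const_mul]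
    rfl
  · exact Eventually.of_forall fun s => (U_integrable h 0 (√(t-s)) (√(1+s)) (x - 2*σ*s)).aestronglyMeasurable
  · exact U_integrable h 0 (√(t-s)) (√(1+s)) (x - 2*σ*s)
  · apply Continuous.aestronglyMeasurable
    have := gk_cont 0
    have := h'.1
    simp only [harg]
    fun_prop
  · refine ae_of_all _ fun ρ s' hs' => ?_
    have p1 : 0 < s' := by linarith [hs'.1]
    have p2 : (t-s)/2 ≤ t - s' := by linarith [hs'.2]
    have q1 : 1 ≤ √(1+s') := by rw [Real.one_le_sqrt]; linarith
    have q2 : (√(1+s'))⁻¹ ≤ 1 := inv_le_one_of_one_le₀ q1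
    have q3 : (√(t-s'))⁻¹ ≤ (√((t-s)/2))⁻¹ := by
      apply inv_anti₀
      · apply Real.sqrt_pos.2; linarith
      · exact Real.sqrt_le_sqrt p2
    have q4 : (1+s')⁻¹ ≤ 1 := inv_le_one_of_one_le₀ (by linarith)
    have e : gk 0 ρ * (χ' (arg s' ρ) *
      (-(2*σ) * (√(1+s'))⁻¹ + (√(1+s'))⁻¹ * (√(t-s'))⁻¹ * (ρ/2) - (1/2) * (1+s')⁻¹ * arg s' ρ))
      = -(gk 0 ρ * ((2*σ) * (χ' (arg s' ρ)) * (√(1+s'))⁻¹)) - gk 1 ρ * (χ' (arg s' ρ) * ((√(1+s'))⁻¹ * (√(t-s'))⁻¹))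
        - gk 0 ρ * ((1/2) * (arg s' ρ * χ' (arg s' ρ)) * (1+s')⁻¹) := by
      rw [gk_one, gk_zero]; ring
    rw [e, Real.norm_eq_abs]
    refine (abs_sub _ _).trans ?_
    refine (add_le_add_left (abs_sub _ _) _).trans ?_
    rw [abs_neg]
    have b1 : |gk 0 ρ * ((2*σ) * (χ' (arg s' ρ)) * (√(1+s'))⁻¹)| ≤ |gk 0 ρ| * (|2*σ| * K) := by
      rw [abs_mul, abs_mul, abs_mul (2*σ), abs_of_nonneg (a := (√(1+s'))⁻¹) (by positivity)]
      refine mul_le_mul_of_nonneg_left ?_ (abs_nonneg _)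
      calc |2*σ| * |χ' (arg s' ρ)| * (√(1+s'))⁻¹ ≤ |2*σ| * K * 1 := by gcongr; exact h'.le _
        _ = _ := by ring
    have b2 : |gk 1 ρ * (χ' (arg s' ρ) * ((√(1+s'))⁻¹ * (√(t-s'))⁻¹))| ≤ |gk 1 ρ| * (K * (√((t-s)/2))⁻¹) := by
      rw [abs_mul, abs_mul, abs_of_nonneg (a := (√(1+s'))⁻¹ * (√(t-s'))⁻¹) (by positivity)]
      gcongr
      · exact h'.le _
      · calc (√(1+s'))⁻¹ * (√(t-s'))⁻¹ ≤ 1 * (√((t-s)/2))⁻¹ := by gcongr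
          _ = _ := by ring
    have b3 : |gk 0 ρ * ((1/2) * (arg s' ρ * χ' (arg s' ρ)) * (1+s')⁻¹)| ≤ |gk 0 ρ| * (1/2*K) := by
      rw [abs_mul, abs_mul, abs_mul (1/2), abs_of_nonneg (a := (1+s')⁻¹) (by positivity), abs_of_nonneg (a := (1/2:ℝ)) (by positivity)]
      refine mul_le_mul_of_nonneg_left ?_ (abs_nonneg _)
      calc 1/2 * |arg s' ρ * χ' (arg s' ρ)| * (1+s')⁻¹ ≤ 1/2 * K * 1 := by gcongr; exact hy.le _
        _ = _ := by ring
    linarith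
  · exact (hC0.integrable.abs.mul_const _).add (hC1.integrable.abs.mul_const _)
  · refine ae_of_all _ fun ρ s' hs' => ?_
    have p1 : 0 < s' := by linarith [hs'.1]
    have p2 : s' < t := by linarith [hs'.2]
    exact ((hd (arg s' ρ)).comp s' (hargd ρ s' p1 p2)).const_mul (gk 0 ρ)


lemma ii_of_bdd {F : ℝ → ℝ} {h : ℝ → ℝ} {t : ℝ} (ht : 0 ≤ t) (hF : Measurable F)
    (hh : IntervalIntegrable h volume 0 t) (hb : ∀ s ∈ Set.Ioc 0 t, |F s| ≤ h s) :
    IntervalIntegrable F volume 0 t := by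
  refine hh.mono_fun' hF.aestronglyMeasurable ?_
  rw [Set.uIoc_of_le ht]
  exact (ae_restrict_iff' measurableSet_Ioc).2 (ae_of_all _ hb)

lemma ii_isqrt (t : ℝ) (ht : 0 ≤ t) : IntervalIntegrable (fun s => (√(t-s))⁻¹) volume 0 t := by
  have h : IntervalIntegrable (fun s : ℝ => s ^ (-(1/2):ℝ)) volume t 0 :=
    intervalIntegral.intervalIntegrable_rpow' (by norm_num)
  have := h.comp_sub_left t
  simp only [sub_self, sub_zero] at this
  refine ii_of_bdd ht (by fun_prop) this ?_
  intro s hs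
  have hs : 0 ≤ t - s := by linarith [hs.2]
  rw [Real.sqrt_eq_rpow, Real.rpow_neg hs, abs_of_nonneg (by positivity)]

lemma int_isqrt (t : ℝ) (ht : 0 ≤ t) : ∫ s in (0:ℝ)..t, (√(t-s))⁻¹ = 2 * √t := by
  rw [intervalIntegral.integral_comp_sub_left (fun s => (√s)⁻¹) t]
  simp only [sub_self, sub_zero]
  have : ∫ s in (0:ℝ)..t, (√s)⁻¹ = ∫ s in (0:ℝ)..t, s ^ (-(1/2):ℝ) := by
    apply intervalIntegral.integral_congr
    intro s hs
    rw [Set.uIcc_of_le ht] at hs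
    simp only
    rw [Real.sqrt_eq_rpow, Real.rpow_neg hs.1]
  rw [this, integral_rpow (by left; norm_num), Real.sqrt_eq_rpow]
  norm_num
  ring

lemma mink_interval (F : ℝ → ℝ → ℝ) (hF : Measurable (Function.uncurry F)) (h : ℝ → ℝ) (t : ℝ) (ht : 0 ≤ t)
    (hh : IntervalIntegrable h volume 0 t) (h0 : ∀ s ∈ Set.Ioc 0 t, 0 ≤ h s)
    (hb : ∀ s ∈ Set.Ioc 0 t, eLpNorm (F s) 2 volume ≤ ENNReal.ofReal (h s)) :
    eLpNorm (fun x => ∫ s in (0:ℝ)..t, F s x) 2 volume ≤ ENNReal.ofReal (∫ s in (0:ℝ)..t, h s) := by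
  simp_rw [intervalIntegral.integral_of_le ht]
  refine (mink (volume.restrict (Set.Ioc 0 t)) F hF).trans ?_
  rw [ofReal_integral_eq_lintegral_ofReal]
  · exact setLIntegral_mono' measurableSet_Ioc hb
  · exact (intervalIntegrable_iff_integrableOn_Ioc_of_le ht).1 hh
  · exact (ae_restrict_iff' measurableSet_Ioc).2 (ae_of_all _ h0)

lemma rpow_contOn (γ t : ℝ) : ContinuousOn (fun s : ℝ => (1+s)^γ) (Set.Icc 0 t) := by
  apply ContinuousOn.rpow_const (by fun_prop)
  intro s hs; left; linarith [hs.1]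

lemma ident {K : ℝ} {χ χ' Y : ℝ → ℝ} (γ : ℝ) (h : Gd K χ) (h' : Gd K χ') (hy : Gd K (fun y => y * χ' y))
    (hY : Gd K Y) (hYe : ∀ y, Y y = γ * χ y - y * χ' y / 2)
    (hd : ∀ x, HasDerivAt χ (χ' x) x) (σ t : ℝ) (ht : 0 ≤ t) (x : ℝ) :
    2 * σ * ∫ s in (0:ℝ)..t, (1+s)^(γ - 1/2) * U 0 (√(t-s)) (√(1+s)) χ' (x - 2*σ*s)
      = U 0 (√t) 1 χ x - (1+t)^γ * U 0 0 (√(1+t)) χ (x - 2*σ*t)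
        + (∫ s in (0:ℝ)..t, (1+s)^(γ - 1) * U 0 (√(t-s)) (√(1+s)) Y (x - 2*σ*s))
        - ∫ s in (0:ℝ)..t, (√(t-s))⁻¹ * ((1+s)^(γ - 1/2) * U 1 (√(t-s)) (√(1+s)) χ' (x - 2*σ*s)) := by
  have hI : ∀ (g : ℝ) j p, Gd K p → ContinuousOn
      (fun s => (1+s)^g * U j (√(t-s)) (√(1+s)) p (x - 2*σ*s)) (Set.Icc 0 t) := by
    intro g j p hp
    exact (rpow_contOn g t).mul (U_contOn hp j σ t x)
  have hI' : ∀ (g : ℝ) j p, Gd K p → IntervalIntegrable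
      (fun s => (1+s)^g * U j (√(t-s)) (√(1+s)) p (x - 2*σ*s)) volume 0 t := by
    intro g j p hp
    apply ContinuousOn.intervalIntegrable
    rw [Set.uIcc_of_le ht]
    exact hI g j p hp
  have hS : IntervalIntegrable (fun s => (√(t-s))⁻¹ * ((1+s)^(γ - 1/2) * U 1 (√(t-s)) (√(1+s)) χ' (x - 2*σ*s))) volume 0 t := by
    apply (ii_isqrt t ht).mul_continuousOn
    rw [Set.uIcc_of_le ht]
    exact hI _ 1 χ' h'
  have ftc := intervalIntegral.integral_eq_sub_of_hasDerivAt_of_le ht (hI γ 0 χ h)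
    (f' := fun s => (1+s)^(γ - 1) * U 0 (√(t-s)) (√(1+s)) Y (x - 2*σ*s)
      - 2 * σ * ((1+s)^(γ - 1/2) * U 0 (√(t-s)) (√(1+s)) χ' (x - 2*σ*s))
      - (√(t-s))⁻¹ * ((1+s)^(γ - 1/2) * U 1 (√(t-s)) (√(1+s)) χ' (x - 2*σ*s))) ?_ ?_
  · rw [intervalIntegral.integral_sub ((hI' _ 0 Y hY).sub ((hI' _ 0 χ' h').const_mul _)) hS,
      intervalIntegral.integral_sub (hI' _ 0 Y hY) ((hI' _ 0 χ' h').const_mul _),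
      intervalIntegral.integral_const_mul] at ftc
    simp only [sub_self, sub_zero, add_zero, Real.sqrt_zero, Real.sqrt_one, Real.one_rpow, one_mul, mul_zero] at ftc
    linarith
  · intro s hs
    have p1 : 0 < 1 + s := by linarith [hs.1]
    have d1 : HasDerivAt (fun s : ℝ => (1+s)^γ) (γ * (1+s)^(γ-1)) s := by
      have := ((hasDerivAt_id s).const_add 1).rpow_const (p := γ) (Or.inl p1.ne')
      refine this.congr_deriv ?_
      simp
    have d2 := U_deriv_s h h' hy hd σ t x s hs.1 hs.2
    refine (d1.mul d2).congr_deriv ?_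
    have e1 : (1+s)^γ * (√(1+s))⁻¹ = (1+s)^(γ - 1/2) := by
      rw [Real.sqrt_eq_rpow, ← Real.rpow_neg p1.le, ← Real.rpow_add p1]; rfl
    have e2 : (1+s)^γ * (1+s)⁻¹ = (1+s)^(γ - 1) := by
      rw [← Real.rpow_neg_one (1+s), ← Real.rpow_add p1]; rfl
    have e3 : U 0 (√(t-s)) (√(1+s)) Y (x - 2*σ*s) = γ * U 0 (√(t-s)) (√(1+s)) χ (x - 2*σ*s)
        - 1/2 * U 0 (√(t-s)) (√(1+s)) (fun y => y * χ' y) (x - 2*σ*s) := by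
      unfold U
      rw [← integral_const_mul, ← integral_const_mul, ← integral_sub]
      · congr 1; ext ρ; rw [hYe]; ring
      · exact (U_integrable h 0 _ _ _).const_mul _
      · exact (U_integrable hy 0 _ _ _).const_mul _
    rw [e3, ← e2, ← e1]
    ring
  · exact ((hI' _ 0 Y hY).sub ((hI' _ 0 χ' h').const_mul _)).sub hS


lemma meas_int (F : ℝ → ℝ → ℝ) (hF : Measurable (Function.uncurry F)) (t : ℝ) (ht : 0 ≤ t) :
    AEStronglyMeasurable (fun x => ∫ s in (0:ℝ)..t, F s x) volume := by
  simp_rw [intervalIntegral.integral_of_le ht]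
  have h : StronglyMeasurable (Function.uncurry F) := hF.stronglyMeasurable
  exact (h.integral_prod_left (μ := volume.restrict (Set.Ioc 0 t))).aestronglyMeasurable

lemma eLpNorm_cmul (c : ℝ) (f : ℝ → ℝ) :
    eLpNorm (fun x => c * f x) 2 volume = ENNReal.ofReal |c| * eLpNorm f 2 volume := by
  have := eLpNorm_const_smul c f 2 volume
  rw [← ofReal_norm] at this
  exact this

lemma eLpNorm_cmul_le (c B : ℝ) (f : ℝ → ℝ) (h : eLpNorm f 2 volume ≤ ENNReal.ofReal B) :
    eLpNorm (fun x => c * f x) 2 volume ≤ ENNReal.ofReal (|c| * B) := by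
  rw [eLpNorm_cmul, ENNReal.ofReal_mul (abs_nonneg _)]
  gcongr

lemma eLpNorm_add_le' {f g : ℝ → ℝ} {A B : ℝ} (hf : AEStronglyMeasurable f volume)
    (hg : AEStronglyMeasurable g volume) (hA : 0 ≤ A) (hB : 0 ≤ B)
    (h1 : eLpNorm f 2 volume ≤ ENNReal.ofReal A) (h2 : eLpNorm g 2 volume ≤ ENNReal.ofReal B) :
    eLpNorm (fun x => f x + g x) 2 volume ≤ ENNReal.ofReal (A + B) := by
  rw [ENNReal.ofReal_add hA hB]
  exact (eLpNorm_add_le hf hg (by norm_num)).trans (add_le_add h1 h2)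

lemma eLpNorm_sub_le' {f g : ℝ → ℝ} {A B : ℝ} (hf : AEStronglyMeasurable f volume)
    (hg : AEStronglyMeasurable g volume) (hA : 0 ≤ A) (hB : 0 ≤ B)
    (h1 : eLpNorm f 2 volume ≤ ENNReal.ofReal A) (h2 : eLpNorm g 2 volume ≤ ENNReal.ofReal B) :
    eLpNorm (fun x => f x - g x) 2 volume ≤ ENNReal.ofReal (A + B) := by
  rw [ENNReal.ofReal_add hA hB]
  exact (eLpNorm_sub_le hf hg (by norm_num)).trans (add_le_add h1 h2)

lemma Chain.pred {K : ℝ} {k : ℕ} {X : ℕ → ℝ → ℝ} (h : Chain K (k+1) X) : Chain K k X :=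
  ⟨fun i hi => h.gd i (by omega), fun i hi => h.der i (by omega)⟩

lemma pow_sqrt (y : ℝ) (hy : 0 ≤ y) (m : ℕ) : √y ^ m = y ^ ((m:ℝ)/2) := by
  rw [Real.sqrt_eq_rpow, ← Real.rpow_natCast, ← Real.rpow_mul hy]; congr 1; ring

lemma mainL (α : ℝ) (hα : α ≤ 1/2) (σ : ℝ) (hσ : σ = 1 ∨ σ = -1) (k : ℕ) :
    ∃ C : ℝ, 0 < C ∧ ∀ K X Y, Chain K (k+1) X → Chain K k Y → Gd K (fun y => y * X (k+1) y) →
      (∀ y, Y k y = (α - 1 - k/2) * X k y - y * X (k+1) y / 2) → ∀ t, 0 ≤ t →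
      eLpNorm (fun x => ∫ s in (0:ℝ)..t, (1+s)^(α - 1 - k/2 - 1/2) *
        U 0 (√(t-s)) (√(1+s)) (X (k+1)) (x - 2*σ*s)) 2 volume
      ≤ ENNReal.ofReal (C * K * Real.log (2+t) * (1+t) ^ (-(1/4 + k/2 : ℝ))) := by
  obtain ⟨c1, hc1, h1⟩ := smoothing 0 k
  obtain ⟨c2, hc2, h2⟩ := smoothing 1 (k+1)
  refine ⟨3 * c1 + 2 * c2, by positivity, ?_⟩
  intro K X Y hX hY hy hYe t ht
  have hK := hy.nonneg
  set γ : ℝ := α - 1 - k/2 with hγ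
  set T : ℝ := 1 + t with hT
  have hT1 : 1 ≤ T := by linarith
  have hTpos : 0 < T := by linarith
  set P : ℝ := T ^ (-(1/4 + k/2 : ℝ)) with hP
  have hPpos : 0 < P := by positivity
  have hσ2 : σ * σ = 1 := by rcases hσ with h | h <;> rw [h] <;> norm_num
  have hσa : |σ| = 1 := by rcases hσ with h | h <;> rw [h] <;> norm_num
  -- the four pieces
  set A : ℝ → ℝ := fun x => U 0 (√t) 1 (X k) x with hA
  set B : ℝ → ℝ := fun x => (1+t)^γ * U 0 0 (√(1+t)) (X k) (x - 2*σ*t) with hB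
  set F1 : ℝ → ℝ → ℝ := fun s x => (1+s)^(γ - 1) * U 0 (√(t-s)) (√(1+s)) (Y k) (x - 2*σ*s) with hF1
  set F2 : ℝ → ℝ → ℝ := fun s x => (√(t-s))⁻¹ * ((1+s)^(γ - 1/2) * U 1 (√(t-s)) (√(1+s)) (X (k+1)) (x - 2*σ*s)) with hF2
  have hXk := hX.gd k (by omega)
  have hXk1 := hX.gd (k+1) (by omega)
  have hYk := hY.gd k (by omega)
  have e : (fun x => ∫ s in (0:ℝ)..t, (1+s)^(γ - 1/2) *
        U 0 (√(t-s)) (√(1+s)) (X (k+1)) (x - 2*σ*s))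
      = fun x => (σ/2) * (((A x - B x) + ∫ s in (0:ℝ)..t, F1 s x) - ∫ s in (0:ℝ)..t, F2 s x) := by
    ext x
    have := ident γ hXk hXk1 hy hYk hYe (hX.der k (by omega)) σ t ht x
    simp only [hA, hB, hF1, hF2]
    rw [← this]
    linear_combination (-(∫ s in (0:ℝ)..t, (1+s)^(γ - 1/2) *
        U 0 (√(t-s)) (√(1+s)) (X (k+1)) (x - 2*σ*s))) * hσ2
  have mU : ∀ j p, Continuous p → Measurable (Function.uncurry fun s x => U j (√(t-s)) (√(1+s)) p (x - 2*σ*s)) := by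
    intro j p hp
    exact U_meas j p hp (fun s => √(t-s)) (fun s => √(1+s)) (fun s => 2*σ*s) (by fun_prop) (by fun_prop) (by fun_prop)
  have mF1 : Measurable (Function.uncurry F1) := by
    have : Measurable (fun q : ℝ × ℝ => (1+q.1)^(γ-1)) := by fun_prop
    exact this.mul (mU 0 (Y k) hYk.1)
  have mF2 : Measurable (Function.uncurry F2) := by
    have a1 : Measurable (fun q : ℝ × ℝ => (1+q.1)^(γ-1/2)) := by fun_prop
    have a2 : Measurable (fun q : ℝ × ℝ => (√(t-q.1))⁻¹) := by fun_prop
    exact a2.mul (a1.mul (mU 1 (X (k+1)) hXk1.1))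
  have mA : AEStronglyMeasurable A volume := by
    have := (U_meas 0 (X k) hXk.1 (fun _ => √t) (fun _ => 1) (fun _ => 0) (by fun_prop) (by fun_prop) (by fun_prop)).comp
      (measurable_prodMk_left (x := (0:ℝ)))
    refine this.aestronglyMeasurable.congr (ae_of_all _ fun x => ?_)
    simp [hA, Function.uncurry]
  have mB : AEStronglyMeasurable B volume := by
    have := (U_meas 0 (X k) hXk.1 (fun _ => 0) (fun _ => √(1+t)) (fun _ => 2*σ*t) (by fun_prop) (by fun_prop) (by fun_prop)).comp
      (measurable_prodMk_left (x := (0:ℝ)))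
    exact (this.const_mul ((1+t)^γ)).aestronglyMeasurable
  -- bounds
  have bA : eLpNorm A 2 volume ≤ ENNReal.ofReal (c1 * K * P) := by
    have := h1 K X hX.pred (√t) 1 0 T (by positivity) one_pos (by rw [Real.sq_sqrt ht]; ring)
    simp only [sub_zero, one_pow, mul_one] at this
    exact this
  have bB : eLpNorm B 2 volume ≤ ENNReal.ofReal (c1 * K * P) := by
    have := h1 K X hX.pred 0 (√(1+t)) (2*σ*t) T le_rfl (by positivity) (by rw [Real.sq_sqrt hTpos.le]; ring)
    refine (eLpNorm_cmul_le _ _ _ this).trans (ENNReal.ofReal_le_ofReal ?_)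
    rw [abs_of_nonneg (by positivity), pow_sqrt _ hTpos.le]
    have : (1+t)^γ * (1+t)^(((k+1:ℕ):ℝ)/2) ≤ 1 := by
      rw [← Real.rpow_add hTpos]
      apply Real.rpow_le_one_of_one_le_of_nonpos hT1
      rw [hγ]; push_cast; linarith
    calc _ = c1 * K * P * ((1+t)^γ * (1+t)^(((k+1:ℕ):ℝ)/2)) := by ring
      _ ≤ c1 * K * P * 1 := by gcongr
      _ = _ := by ring
  have bF1 : eLpNorm (fun x => ∫ s in (0:ℝ)..t, F1 s x) 2 volume ≤ ENNReal.ofReal (c1 * K * P * Real.log (1+t)) := by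
    have hint : IntervalIntegrable (fun s : ℝ => c1 * K * P * (1+s)⁻¹) volume 0 t := by
      apply ContinuousOn.intervalIntegrable
      rw [Set.uIcc_of_le ht]
      apply ContinuousOn.mul continuousOn_const
      apply ContinuousOn.inv₀ (by fun_prop)
      intro s hs; linarith [hs.1]
    have := mink_interval F1 mF1 (fun s => c1 * K * P * (1+s)⁻¹) t ht hint ?_ ?_
    · rw [intervalIntegral.integral_const_mul] at this
      have e : ∫ s in (0:ℝ)..t, (1+s)⁻¹ = Real.log (1+t) := by
        rw [intervalIntegral.integral_comp_add_left (fun s => s⁻¹) 1, integral_inv_of_pos (by norm_num) (by linarith)]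
        simp
      rwa [e] at this
    · intro s hs
      have : 0 < 1 + s := by linarith [hs.1]
      positivity
    · intro s hs
      have p1 : 1 ≤ 1 + s := by linarith [hs.1]
      have p0 : 0 < 1 + s := by linarith
      have := h1 K Y hY (√(t-s)) (√(1+s)) (2*σ*s) T (by positivity) (by positivity)
        (by rw [Real.sq_sqrt p0.le, Real.sq_sqrt (by linarith [hs.2])]; ring)
      refine (eLpNorm_cmul_le _ _ _ this).trans (ENNReal.ofReal_le_ofReal ?_)
      rw [abs_of_nonneg (by positivity), pow_sqrt _ p0.le]
      have : (1+s)^(γ-1) * (1+s)^(((k+1:ℕ):ℝ)/2) ≤ (1+s)⁻¹ := by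
        rw [← Real.rpow_add p0, ← Real.rpow_neg_one]
        apply Real.rpow_le_rpow_of_exponent_le p1
        rw [hγ]; push_cast; linarith
      calc _ = c1 * K * P * ((1+s)^(γ-1) * (1+s)^(((k+1:ℕ):ℝ)/2)) := by ring
        _ ≤ _ := by gcongr
  have bF2 : eLpNorm (fun x => ∫ s in (0:ℝ)..t, F2 s x) 2 volume ≤ ENNReal.ofReal (c2 * K * P * 2) := by
    set Q : ℝ := T ^ (-(1/4 + ((k+1:ℕ):ℝ)/2 : ℝ)) with hQ
    have hQpos : 0 < Q := by positivity
    have := mink_interval F2 mF2 (fun s => c2 * K * Q * (√(t-s))⁻¹) t ht ((ii_isqrt t ht).const_mul _) ?_ ?_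
    · refine this.trans (ENNReal.ofReal_le_ofReal ?_)
      rw [intervalIntegral.integral_const_mul, int_isqrt t ht]
      have : Q * √t ≤ P := by
        calc Q * √t ≤ Q * √T := by gcongr; linarith
          _ = P := by
            rw [hQ, hP, Real.sqrt_eq_rpow, ← Real.rpow_add hTpos]; congr 1; push_cast; ring
      calc _ = c2 * K * (Q * √t) * 2 := by ring
        _ ≤ _ := by gcongr
    · intro s hs
      positivity
    · intro s hs
      have p1 : 1 ≤ 1 + s := by linarith [hs.1]
      have p0 : 0 < 1 + s := by linarith
      have := h2 K X hX (√(t-s)) (√(1+s)) (2*σ*s) T (by positivity) (by positivity)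
        (by rw [Real.sq_sqrt p0.le, Real.sq_sqrt (by linarith [hs.2])]; ring)
      refine (eLpNorm_cmul_le _ _ _ (eLpNorm_cmul_le _ _ _ this)).trans (ENNReal.ofReal_le_ofReal ?_)
      rw [abs_of_nonneg (by positivity), abs_of_nonneg (by positivity), pow_sqrt _ p0.le]
      have : (1+s)^(γ-1/2) * (1+s)^(((k+1+1:ℕ):ℝ)/2) ≤ 1 := by
        rw [← Real.rpow_add p0]
        apply Real.rpow_le_one_of_one_le_of_nonpos p1
        rw [hγ]; push_cast; linarith
      calc _ = c2 * K * Q * (√(t-s))⁻¹ * ((1+s)^(γ-1/2) * (1+s)^(((k+1+1:ℕ):ℝ)/2)) := by ring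
        _ ≤ c2 * K * Q * (√(t-s))⁻¹ * 1 := by gcongr
        _ = _ := by ring
  have hlog0 : 0 ≤ Real.log (1+t) := Real.log_nonneg (by linarith)
  rw [e]
  have tot := eLpNorm_cmul_le (σ/2) _ _ (eLpNorm_sub_le' ((mA.sub mB).add (meas_int F1 mF1 t ht)) (meas_int F2 mF2 t ht)
    (by positivity) (by positivity)
    (eLpNorm_add_le' (mA.sub mB) (meas_int F1 mF1 t ht) (by positivity) (by positivity)
      (eLpNorm_sub_le' mA mB (by positivity) (by positivity) bA bB) bF1) bF2)
  refine tot.trans (ENNReal.ofReal_le_ofReal ?_)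
  rw [abs_div, hσa]
  have l1 : 1 ≤ 2 * Real.log (2+t) := by
    have : Real.log 2 ≤ Real.log (2+t) := Real.log_le_log (by norm_num) (by linarith)
    linarith [Real.log_two_gt_d9]
  have l2 : Real.log (1+t) ≤ Real.log (2+t) := Real.log_le_log (by linarith) (by linarith)
  have hKP : 0 ≤ K * P := by positivity
  norm_num
  have m1 : c1 * (K * P) * 1 ≤ c1 * (K * P) * (2 * Real.log (2+t)) := by gcongr
  have m2 : c2 * (K * P) * 1 ≤ c2 * (K * P) * (2 * Real.log (2+t)) := by gcongr
  have m3 : c1 * (K * P) * Real.log (1+t) ≤ c1 * (K * P) * Real.log (2+t) := by gcongr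
  have m4 : 0 ≤ c1 * (K * P) * Real.log (2+t) := by
    have : 0 ≤ Real.log (2+t) := by linarith
    positivity
  nlinarith


lemma U_deriv_x {K : ℝ} {X X' : ℝ → ℝ} (h : Gd K X) (h' : Gd K X') (hd : ∀ x, HasDerivAt X (X' x) x)
    (j : ℕ) (a l : ℝ) (x : ℝ) : HasDerivAt (U j a l X) (l⁻¹ * U j a l X' x) x := by
  obtain ⟨C, hC⟩ := gk_gd j
  have key := (hasDerivAt_integral_of_dominated_loc_of_deriv_le (μ := volume) (x₀ := x) (s := Set.univ)
    (F := fun x ρ => gk j ρ * X ((x - a * ρ) / l))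
    (F' := fun x ρ => gk j ρ * (l⁻¹ * X' ((x - a * ρ) / l)))
    (bound := fun ρ => |gk j ρ| * (|l⁻¹| * K)) Filter.univ_mem
    (Filter.Eventually.of_forall fun y => (U_integrable h j a l y).aestronglyMeasurable)
    (U_integrable h j a l x)
    ?_ ?_ ?_ ?_).2
  · refine key.congr_deriv ?_
    unfold U
    rw [← integral_const_mul]
    congr 1; ext ρ; ring
  · have := ((U_integrable h' j a l x).const_mul l⁻¹).aestronglyMeasurable
    refine this.congr (ae_of_all _ fun ρ => ?_)
    simp only; ring
  · refine ae_of_all _ fun ρ y _ => ?_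
    rw [Real.norm_eq_abs, abs_mul, abs_mul]
    gcongr
    exact h'.le _
  · exact hC.integrable.abs.mul_const _
  · refine ae_of_all _ fun ρ y _ => ?_
    have h1 : HasDerivAt (fun y => (y - a * ρ) / l) (l⁻¹) y := by
      have := ((hasDerivAt_id y).sub_const (a * ρ)).div_const l
      refine this.congr_deriv ?_
      simp
    have := ((hd ((y - a * ρ) / l)).comp y h1).const_mul (gk j ρ)
    refine this.congr_deriv ?_
    ring

noncomputable def W (γ σ : ℝ) (χ : ℝ → ℝ) (t x : ℝ) : ℝ :=
  ∫ s in (0:ℝ)..t, (1+s)^γ * U 0 (√(t-s)) (√(1+s)) χ (x - 2*σ*s)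

lemma W_cont {K : ℝ} {χ : ℝ → ℝ} (h : Gd K χ) (γ σ t x : ℝ) :
    ContinuousOn (fun s => (1+s)^γ * U 0 (√(t-s)) (√(1+s)) χ (x - 2*σ*s)) (Set.Icc 0 t) :=
  (rpow_contOn γ t).mul (U_contOn h 0 σ t x)

lemma W_ii {K : ℝ} {χ : ℝ → ℝ} (h : Gd K χ) (γ σ t x : ℝ) (ht : 0 ≤ t) :
    IntervalIntegrable (fun s => (1+s)^γ * U 0 (√(t-s)) (√(1+s)) χ (x - 2*σ*s)) volume 0 t := by
  apply ContinuousOn.intervalIntegrable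
  rw [Set.uIcc_of_le ht]
  exact W_cont h γ σ t x

lemma W_deriv {K : ℝ} {X X' : ℝ → ℝ} (h : Gd K X) (h' : Gd K X') (hd : ∀ x, HasDerivAt X (X' x) x)
    (γ σ t : ℝ) (ht : 0 ≤ t) (x : ℝ) :
    HasDerivAt (W γ σ X t) (W (γ - 1/2) σ X' t x) x := by
  obtain ⟨c, hc, hb⟩ := U_bound 0
  have e : ∀ y, W (γ - 1/2) σ X' t y = ∫ s in (0:ℝ)..t, (1+s)^γ * ((√(1+s))⁻¹ * U 0 (√(t-s)) (√(1+s)) X' (y - 2*σ*s)) := by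
    intro y
    unfold W
    apply intervalIntegral.integral_congr
    intro s hs
    rw [Set.uIcc_of_le ht] at hs
    have : 0 < 1 + s := by linarith [hs.1]
    simp only
    rw [Real.rpow_sub this, Real.sqrt_eq_rpow (1+s)]
    ring
  rw [e]
  have hK := h'.nonneg
  have hKm := h.nonneg
  refine (intervalIntegral.hasDerivAt_integral_of_dominated_loc_of_deriv_le (μ := volume) (x₀ := x) (s := Set.univ)
    (F := fun y s => (1+s)^γ * U 0 (√(t-s)) (√(1+s)) X (y - 2*σ*s))
    (F' := fun y s => (1+s)^γ * ((√(1+s))⁻¹ * U 0 (√(t-s)) (√(1+s)) X' (y - 2*σ*s)))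
    (bound := fun s => (1+s)^γ * (c * K)) Filter.univ_mem
    (Filter.Eventually.of_forall fun y => ?_)
    (W_ii h γ σ t x ht)
    ?_ ?_ ?_ ?_).2
  · have := (intervalIntegrable_iff.1 (W_ii h γ σ t y ht)).aestronglyMeasurable
    exact this
  · have := U_meas_s 0 X' h'.1 (fun s => √(t-s)) (fun s => √(1+s)) (fun s => 2*σ*s) (by fun_prop) (by fun_prop) (by fun_prop) x
    apply Measurable.aestronglyMeasurable
    have a1 : Measurable (fun s : ℝ => (1+s)^γ) := by fun_prop
    have a2 : Measurable (fun s : ℝ => (√(1+s))⁻¹) := by fun_prop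
    exact a1.mul (a2.mul this)
  · refine ae_of_all _ fun s hs y _ => ?_
    rw [Set.uIoc_of_le ht] at hs
    have hs0 : 0 < 1 + s := by linarith [hs.1]
    rw [Real.norm_eq_abs, abs_mul, abs_of_nonneg (a := (1+s)^γ) (by positivity), abs_mul,
      abs_of_nonneg (a := (√(1+s))⁻¹) (by positivity)]
    have h1 : (√(1+s))⁻¹ ≤ 1 := by
      apply inv_le_one_of_one_le₀
      rw [Real.one_le_sqrt]; linarith [hs.1]
    apply mul_le_mul_of_nonneg_left _ (by positivity)
    have h2 := hb K X' h' (√(t-s)) (√(1+s)) (y - 2*σ*s)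
    calc _ ≤ 1 * (c * K) := mul_le_mul h1 h2 (abs_nonneg _) zero_le_one
      _ = _ := one_mul _
  · apply ContinuousOn.intervalIntegrable
    rw [Set.uIcc_of_le ht]
    exact (rpow_contOn γ t).mul continuousOn_const
  · refine ae_of_all _ fun s hs y _ => ?_
    apply HasDerivAt.const_mul
    have := (U_deriv_x h h' hd 0 (√(t-s)) (√(1+s)) (y - 2*σ*s)).comp y ((hasDerivAt_id y).sub_const (2*σ*s))
    refine this.congr_deriv ?_
    ring

lemma heat_scale (a z : ℝ) (ha : 0 < a) : heatKernel (a^2) z = a⁻¹ * gk 0 (z / a) := by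
  rw [heatKernel, gk_zero, show 4 * π * a^2 = a^2 * (4*π) by ring, Real.sqrt_mul (by positivity),
    Real.sqrt_sq ha.le, show -z^2/(4*a^2) = -(z/a)^2/4 by field_simp]
  field_simp

lemma heat_deriv (a x y : ℝ) (ha : 0 < a) :
    deriv (fun x' => heatKernel (a^2) (x' - y)) x = (a⁻¹)^2 * gk 1 ((x - y)/a) := by
  simp_rw [heat_scale a _ ha]
  apply HasDerivAt.deriv
  have h1 : HasDerivAt (fun x' => (x' - y)/a) (a⁻¹) x := by
    have := ((hasDerivAt_id x).sub_const y).div_const a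
    refine this.congr_deriv ?_
    simp
  have := ((hasDerivAt_gk 0 ((x-y)/a)).comp x h1).const_mul a⁻¹
  refine this.congr_deriv ?_
  ring

lemma subst_aff (H : ℝ → ℝ) (a x : ℝ) (ha : 0 < a) : ∫ y, H y = a * ∫ ρ, H (x - a * ρ) := by
  rw [← integral_sub_left_eq_self H volume x, Measure.integral_comp_mul_left (fun y => H (x - y)) a,
    abs_of_pos (by positivity), smul_eq_mul]
  field_simp

lemma duhamel_eq {K : ℝ} {f f' : ℝ → ℝ} (h : Gd K f) (h' : Gd K f') (hd : ∀ x, HasDerivAt f (f' x) x)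
    (n : ℕ) (σ t x : ℝ) (ht : 0 ≤ t) :
    duhamel (forcing n σ f) x t = W ((2:ℝ)^(-(n:ℝ)) - 2) σ f' t x := by
  unfold duhamel W
  apply intervalIntegral.integral_congr_ae
  have hne : ∀ᵐ s : ℝ, s ≠ t := by
    simp [ae_iff]
  filter_upwards [hne] with s hst hs
  rw [Set.uIoc_of_le ht] at hs
  have hs1 : 0 < 1 + s := by linarith [hs.1]
  have hlt : 0 < t - s := by have := lt_of_le_of_ne hs.2 hst; linarith
  have ha : 0 < √(t-s) := by positivity
  have hl : 0 < √(1+s) := by positivity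
  have e : t - s = (√(t-s))^2 := (Real.sq_sqrt hlt.le).symm
  have : ∀ y, deriv (fun x' => heatKernel (t-s) (x' - y)) x = ((√(t-s))⁻¹)^2 * gk 1 ((x-y)/√(t-s)) := by
    intro y
    rw [← heat_deriv _ _ _ ha, Real.sq_sqrt hlt.le]
  simp_rw [this]
  rw [subst_aff _ _ x ha, U_ibp h h' hd 0 _ _ ha hl]
  unfold U
  rw [← mul_assoc, ← integral_const_mul, ← integral_const_mul]
  congr 1; ext ρ
  unfold forcing
  rw [show (x - (x - √(t-s) * ρ))/√(t-s) = ρ by field_simp; ring,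
    show x - √(t-s) * ρ - 2*σ*s = x - 2*σ*s - √(t-s) * ρ by ring]
  have e3 : (1+s)^((2:ℝ)^(-(n:ℝ)) - 2) = (1+s)^((2:ℝ)^(-(n:ℝ)) - 3/2) * (√(1+s))⁻¹ := by
    rw [Real.sqrt_eq_rpow, ← Real.rpow_neg hs1.le, ← Real.rpow_add hs1]
    congr 1; ring
  rw [e3]
  field_simp


lemma gauss_conv (a l T x : ℝ) (hl : 0 < l) (hT : 0 < T) (h : a^2 + l^2 = T) :
    U 0 a l (gk 0) x = l / √T * gk 0 (x / √T) := by
  unfold U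
  have e : ∀ ρ, gk 0 ρ * gk 0 ((x - a * ρ)/l) =
      (exp (-(x/√T)^2/4) / (4*π)) * exp (-(T/(4*l^2)) * (ρ - a * x/T)^2) := by
    intro ρ
    rw [gk_zero, gk_zero]
    have h4 : √(4*π) * √(4*π) = 4*π := Real.mul_self_sqrt (by positivity)
    rw [div_mul_div_comm, h4, ← exp_add, div_mul_eq_mul_div, ← exp_add]
    congr 2
    have e9 : (x/√T)^2 = x^2/T := by rw [div_pow, Real.sq_sqrt hT.le]
    rw [e9]
    field_simp
    rw [← h]; ring
  simp_rw [e]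
  rw [integral_const_mul, integral_sub_right_eq_self (fun ρ => exp (-(T/(4*l^2)) * ρ^2)) (a*x/T),
    integral_gaussian, gk_zero]
  have e2 : √(π / (T/(4*l^2))) = l * √(4*π) / √T := by
    rw [show π / (T/(4*l^2)) = l^2 * (4*π) / T by field_simp, Real.sqrt_div (by positivity),
      Real.sqrt_mul (by positivity), Real.sqrt_sq hl.le]
  rw [e2]
  have h4 : √(4*π) * √(4*π) = 4*π := Real.mul_self_sqrt (by positivity)
  have h5 : 0 < √(4*π) := by positivity
  have h6 : 0 < √T := by positivity
  rw [show exp (-(x/√T)^2/4) / (4*π) = exp (-(x/√T)^2/4) / (√(4*π) * √(4*π)) by rw [h4]]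
  generalize √(4*π) = w at *
  field_simp

lemma gk_gd2 (k : ℕ) : ∃ K, Gd K (gk k) ∧ Gd K (gk (k+1)) := by
  obtain ⟨C, hC⟩ := gk_gd k
  obtain ⟨D, hD⟩ := gk_gd (k+1)
  exact ⟨max C D, hC.mono (le_max_left _ _), hD.mono (le_max_right _ _)⟩

lemma gk_comp_deriv (k : ℕ) (r b x : ℝ) :
    HasDerivAt (fun y => gk k ((y - b)/r)) (r⁻¹ * gk (k+1) ((x-b)/r)) x := by
  have h1 : HasDerivAt (fun y => (y - b)/r) (r⁻¹) x := by
    have := ((hasDerivAt_id x).sub_const b).div_const r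
    refine this.congr_deriv ?_
    simp
  refine ((hasDerivAt_gk k ((x-b)/r)).comp x h1).congr_deriv ?_
  ring

lemma gauss_semigroup (k : ℕ) (a l T : ℝ) (hl : 0 < l) (hT : 0 < T) (h : a^2 + l^2 = T) (x : ℝ) :
    U 0 a l (gk k) x = (l / √T)^(k+1) * gk k (x / √T) := by
  induction k generalizing x with
  | zero => simpa using gauss_conv a l T x hl hT h
  | succ k ih =>
    obtain ⟨K, h1, h2⟩ := gk_gd2 k
    have d1 := U_deriv_x h1 h2 (hasDerivAt_gk k) 0 a l x
    have e : U 0 a l (gk k) = fun x => (l / √T)^(k+1) * gk k ((x - 0) / √T) := by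
      ext y; rw [ih, sub_zero]
    rw [e] at d1
    have d2 := (gk_comp_deriv k (√T) 0 x).const_mul ((l/√T)^(k+1))
    have := d1.unique d2
    rw [sub_zero] at this
    have hl' : l ≠ 0 := hl.ne'
    calc _ = l * (l⁻¹ * U 0 a l (gk (k+1)) x) := by field_simp
      _ = _ := by rw [this, pow_succ (l/√T) (k+1)]; ring

lemma W_gauss (α σ t x : ℝ) (k : ℕ) (ht : 0 ≤ t) (γ : ℝ) (hγ : γ = α - 1 - (k+1:ℝ)/2) :
    W γ σ (gk k) t x = ((√(1+t))^(k+1))⁻¹ * ∫ s in (0:ℝ)..t, (1+s)^(α-1) * gk k ((x - 2*σ*s)/√(1+t)) := by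
  unfold W
  rw [← intervalIntegral.integral_const_mul]
  apply intervalIntegral.integral_congr
  intro s hs
  rw [Set.uIcc_of_le ht] at hs
  have hs1 : 0 < 1 + s := by linarith [hs.1]
  have hT : 0 < 1 + t := by linarith
  simp only
  rw [gauss_semigroup k (√(t-s)) (√(1+s)) (1+t) (by positivity) hT
    (by rw [Real.sq_sqrt (by linarith [hs.2]), Real.sq_sqrt hs1.le]; ring)]
  rw [div_pow, pow_sqrt (1+s) hs1.le]
  have : (1+s)^(α-1) = (1+s)^γ * (1+s)^(((k+1:ℕ):ℝ)/2) := by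
    rw [← Real.rpow_add hs1, hγ]; congr 1; push_cast; ring
  rw [this]
  field_simp

/-! singular integrals -/

lemma sing_int {p : ℝ → ℝ} {B α : ℝ} (hα : 0 < α) (hα1 : α ≤ 1) (hp : Continuous p) (hB : ∀ s, |p s| ≤ B)
    (hi : Integrable p) : IntegrableOn (fun s => s^(α-1) * p s) (Set.Ioi 0) := by
  rw [← Set.Ioc_union_Ioi_eq_Ioi (zero_le_one' ℝ)]
  refine IntegrableOn.union ?_ ?_
  · have h : IntegrableOn (fun s : ℝ => s^(α-1)) (Set.Ioc 0 1) :=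
      (intervalIntegrable_iff_integrableOn_Ioc_of_le zero_le_one).1
        (intervalIntegral.intervalIntegrable_rpow' (by linarith))
    exact h.mul_bdd (c := B) hp.aestronglyMeasurable (ae_of_all _ hB)
  · refine hi.integrableOn.bdd_mul (c := 1) ?_ ?_
    · apply Measurable.aestronglyMeasurable; fun_prop
    · refine (ae_restrict_iff' measurableSet_Ioi).2 (ae_of_all _ fun s hs => ?_)
      have hs : 1 < s := hs
      rw [Real.norm_eq_abs, abs_of_nonneg (by positivity)]
      exact Real.rpow_le_one_of_one_le_of_nonpos hs.le (by linarith)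

lemma aff_int {p : ℝ → ℝ} (hp : Integrable p) (σ r x : ℝ) (hσ : σ ≠ 0) (hr : r ≠ 0) :
    Integrable (fun s => p ((x - 2*σ*s)/r)) := by
  have h1 : Integrable (fun y => p (y / r)) := hp.comp_div hr
  have h2 : Integrable (fun y => p ((x - y) / r)) := h1.comp_sub_left x
  exact h2.comp_mul_left' (R := 2*σ) (by simpa using hσ)

noncomputable def V (α σ r : ℝ) (k : ℕ) (x : ℝ) : ℝ :=
  (r^(k+1))⁻¹ * ∫ s in Set.Ioi (0:ℝ), s^(α-1) * gk k ((x - 2*σ*s)/r)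

lemma V_int {α σ r : ℝ} (hα : 0 < α) (hα1 : α ≤ 1) (hσ : σ ≠ 0) (hr : r ≠ 0) (k : ℕ) (x : ℝ) :
    IntegrableOn (fun s => s^(α-1) * gk k ((x - 2*σ*s)/r)) (Set.Ioi 0) := by
  obtain ⟨C, hC⟩ := gk_gd k
  refine sing_int (B := C) hα hα1 ((gk_cont k).comp (by fun_prop)) (fun s => hC.le _) 
    (aff_int hC.integrable σ r x hσ hr)

lemma V_deriv {α σ r : ℝ} (hα : 0 < α) (hα1 : α ≤ 1) (hσ : σ ≠ 0) (hr : 0 < r) (k : ℕ) (x : ℝ) :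
    HasDerivAt (V α σ r k) (V α σ r (k+1) x) x := by
  obtain ⟨C, hC⟩ := gk_gd (k+1)
  have hC0 := hC.nonneg
  have hi : Integrable (fun w : ℝ => exp (-w^2/32)) := by
    have := integrable_exp_neg_mul_sq (b := 1/32) (by norm_num)
    refine this.congr (ae_of_all _ fun w => ?_)
    simp only; congr 1; ring
  have hq : IntegrableOn (fun s => s^(α-1) * exp (-((x - 2*σ*s)/r)^2/32)) (Set.Ioi 0) := by
    refine sing_int (B := 1) hα hα1 (by fun_prop) (fun s => ?_) (aff_int hi σ r x hσ hr.ne')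
    rw [abs_of_pos (exp_pos _)]
    apply Real.exp_le_one_iff.2
    have := sq_nonneg ((x - 2*σ*s)/r)
    linarith
  have key := (hasDerivAt_integral_of_dominated_loc_of_deriv_le (μ := volume.restrict (Set.Ioi 0)) (x₀ := x)
    (s := Metric.ball x 1)
    (F := fun y s => s^(α-1) * gk k ((y - 2*σ*s)/r))
    (F' := fun y s => s^(α-1) * (r⁻¹ * gk (k+1) ((y - 2*σ*s)/r)))
    (bound := fun s => r⁻¹ * C * exp (1/(16*r^2)) * (s^(α-1) * exp (-((x - 2*σ*s)/r)^2/32)))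
    (Metric.ball_mem_nhds x one_pos)
    (Filter.Eventually.of_forall fun y => (V_int hα hα1 hσ hr.ne' k y).aestronglyMeasurable)
    (V_int hα hα1 hσ hr.ne' k x)
    ?_ ?_ ?_ ?_).2
  · refine (key.const_mul (r^(k+1))⁻¹).congr_deriv ?_
    unfold V
    rw [← integral_const_mul, ← integral_const_mul]
    congr 1; ext s
    rw [pow_succ r (k+1)]
    field_simp
  · have := ((V_int hα hα1 hσ hr.ne' (k+1) x).const_mul r⁻¹).aestronglyMeasurable
    refine this.congr (ae_of_all _ fun ρ => ?_)
    simp only; ring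
  · refine (ae_restrict_iff' measurableSet_Ioi).2 (ae_of_all _ fun s hs y hy => ?_)
    have hs : 0 < s := hs
    rw [Real.norm_eq_abs, abs_mul, abs_mul, abs_of_nonneg (a := s^(α-1)) (by positivity),
      abs_of_nonneg (a := r⁻¹) (by positivity)]
    have h1 := hC.2 ((y - 2*σ*s)/r)
    have h2 : exp (-((y - 2*σ*s)/r)^2/16) ≤ exp (1/(16*r^2)) * exp (-((x - 2*σ*s)/r)^2/32) := by
      rw [← exp_add]
      apply exp_le_exp.2
      rw [Metric.mem_ball, Real.dist_eq, abs_lt] at hy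
      rw [div_pow, div_pow]
      have : (x - 2*σ*s)^2 ≤ 2 * (y - 2*σ*s)^2 + 2 := by
        nlinarith [sq_nonneg ((y - 2*σ*s) + (y - x)), mul_nonneg (show 0 ≤ 1 - (y-x) by linarith) (show 0 ≤ 1 + (y-x) by linarith)]
      have e : 1/(16*r^2) + -((x - 2*σ*s)^2/r^2)/32 - -((y - 2*σ*s)^2/r^2)/16
        = (2 * (y - 2*σ*s)^2 + 2 - (x - 2*σ*s)^2)/(32*r^2) := by
        field_simp; ring
      have : 0 ≤ (2 * (y - 2*σ*s)^2 + 2 - (x - 2*σ*s)^2)/(32*r^2) := div_nonneg (by linarith) (by positivity)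
      linarith
    calc s^(α-1) * (r⁻¹ * |gk (k+1) ((y - 2*σ*s)/r)|)
        ≤ s^(α-1) * (r⁻¹ * (C * (exp (1/(16*r^2)) * exp (-((x - 2*σ*s)/r)^2/32)))) := by
          apply mul_le_mul_of_nonneg_left _ (by positivity)
          apply mul_le_mul_of_nonneg_left _ (by positivity)
          exact h1.trans (mul_le_mul_of_nonneg_left h2 hC0)
      _ = _ := by ring
  · exact hq.const_mul _
  · refine ae_of_all _ fun s y _ => ?_
    exact (gk_comp_deriv k r (2*σ*s) y).const_mul _

lemma selfSim_eq (n : ℕ) (σ : ℝ) (hσ : σ^2 = 1) (t x : ℝ) (ht : 0 ≤ t) :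
    selfSimU n σ x t = V ((2:ℝ)^(-(n:ℝ))) σ (√(1+t)) 1 x := by
  unfold selfSimU fn V
  have e0 : (2:ℝ)^(-(n:ℝ) - 1) = (2:ℝ)^(-(n:ℝ)) / 2 := by
    rw [Real.rpow_sub two_pos, Real.rpow_one]
  rw [e0]
  set α := (2:ℝ)^(-(n:ℝ)) with hα
  have hT : 0 < 1 + t := by linarith
  set r := √(1+t) with hr
  have hr0 : 0 < r := by positivity
  set z := -σ * x / r with hz
  have s1 : ∫ ξ in Set.Ioi z, ξ * exp (-ξ^2/4) * (ξ - z)^(α - 1)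
      = (2/r) * ∫ s in Set.Ioi (0:ℝ), (z + 2/r*s) * exp (-(z + 2/r*s)^2/4) * (2/r*s)^(α-1) := by
    have h1 := (measurePreserving_add_left volume z).setIntegral_preimage_emb
      (measurableEmbedding_addLeft z) (fun ξ => ξ * exp (-ξ^2/4) * (ξ - z)^(α - 1)) (Set.Ioi z)
    rw [show (fun y => z + y) ⁻¹' (Set.Ioi z) = Set.Ioi 0 by ext y; simp] at h1
    rw [← h1]
    have h2 := integral_comp_mul_left_Ioi (fun y => (z + y) * exp (-(z+y)^2/4) * (z + y - z)^(α - 1)) 0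
      (show 0 < 2/r by positivity)
    rw [mul_zero] at h2
    simp only [add_sub_cancel_left, smul_eq_mul] at h2 ⊢
    rw [h2]
    field_simp
  have s2 : ∫ s in Set.Ioi (0:ℝ), (z + 2/r*s) * exp (-(z + 2/r*s)^2/4) * (2/r*s)^(α-1)
      = (2*σ*√(4*π) * (2/r)^(α-1)) * ∫ s in Set.Ioi (0:ℝ), s^(α-1) * gk 1 ((x - 2*σ*s)/r) := by
    rw [← integral_const_mul]
    apply setIntegral_congr_fun measurableSet_Ioi
    intro s hs
    have hs : 0 < s := hs
    simp only
    have e1 : z + 2/r*s = -σ * ((x - 2*σ*s)/r) := by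
      rw [hz]; field_simp; linear_combination (-2*s) * hσ
    have e2 : (-σ * ((x - 2*σ*s)/r))^2 = ((x - 2*σ*s)/r)^2 := by rw [mul_pow]; linear_combination ((x - 2*σ*s)/r)^2 * hσ
    rw [e1, gk_one, Real.mul_rpow (by positivity) hs.le, e2]
    field_simp
  rw [s1, s2]
  have e3 : (1+t)^(-1 + α/2) = r^(-2 + α) := by
    rw [hr, Real.sqrt_eq_rpow, ← Real.rpow_mul hT.le]; congr 1; ring
  have e4 : (2/r)^(α-1) = 2^(α-1) * r^(1-α) := by
    rw [Real.div_rpow (by norm_num) hr0.le, div_eq_mul_inv, ← Real.rpow_neg hr0.le]; congr 2; ring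
  have e5 : (2:ℝ)^(-1-α) * 2^(α-1) = 1/4 := by
    rw [← Real.rpow_add two_pos, show -1-α+(α-1) = ((-2:ℤ):ℝ) by push_cast; ring, Real.rpow_intCast]; norm_num
  have e6 : r^(-2+α) * r^(1-α) = r⁻¹ := by
    rw [← Real.rpow_add hr0, show -2+α+(1-α) = -1 by ring, Real.rpow_neg_one]
  rw [e3, e4]
  set I := ∫ s in Set.Ioi (0:ℝ), s^(α-1) * gk 1 ((x - 2*σ*s)/r)
  have h5 : 0 < √(4*π) := by positivity
  calc _ = σ^2 * (r^(-2+α) * r^(1-α)) * ((2:ℝ)^(-1-α) * 2^(α-1)) * (4 / r) * I := by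
        field_simp; ring
    _ = _ := by
        rw [e5, e6, hσ, show (r^(1+1))⁻¹ = r⁻¹ * r⁻¹ by rw [pow_succ, pow_one, mul_inv]]; ring


lemma meas_set (F : ℝ → ℝ → ℝ) (hF : Measurable (Function.uncurry F)) (S : Set ℝ) :
    AEStronglyMeasurable (fun x => ∫ s in S, F s x) volume :=
  (hF.stronglyMeasurable.integral_prod_left (μ := volume.restrict S)).aestronglyMeasurable

lemma mink_set (F : ℝ → ℝ → ℝ) (hF : Measurable (Function.uncurry F)) (h : ℝ → ℝ) (S : Set ℝ) (hS : MeasurableSet S)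
    (hh : IntegrableOn h S) (h0 : ∀ s ∈ S, 0 ≤ h s)
    (hb : ∀ s ∈ S, eLpNorm (F s) 2 volume ≤ ENNReal.ofReal (h s)) :
    eLpNorm (fun x => ∫ s in S, F s x) 2 volume ≤ ENNReal.ofReal (∫ s in S, h s) := by
  refine (mink (volume.restrict S) F hF).trans ?_
  rw [ofReal_integral_eq_lintegral_ofReal]
  · exact setLIntegral_mono' hS hb
  · exact hh
  · exact (ae_restrict_iff' hS).2 (ae_of_all _ h0)

lemma diff_bound {α s : ℝ} (hα : 0 < α) (hα1 : α ≤ 1) (hs : 0 < s) :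
    0 ≤ s^(α-1) - (1+s)^(α-1) ∧ s^(α-1) - (1+s)^(α-1) ≤ s^(α-1) / (1+s) := by
  constructor
  · rw [sub_nonneg]
    exact Real.rpow_le_rpow_of_nonpos hs (by linarith) (by linarith)
  · have h1 : s^α ≤ (1+s)^α := Real.rpow_le_rpow hs.le (by linarith) hα.le
    rw [Real.rpow_sub hs, Real.rpow_sub (by linarith : (0:ℝ) < 1+s), Real.rpow_one, Real.rpow_one]
    have h2 : s^α / s - s^α/(1+s) = s^α / s / (1+s) := by field_simp; ring
    have h3 : s^α/(1+s) ≤ (1+s)^α/(1+s) := by gcongr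
    linarith

lemma diff_int {α : ℝ} (hα : 0 < α) (hα1 : α < 1) :
    IntegrableOn (fun s : ℝ => s^(α-1) - (1+s)^(α-1)) (Set.Ioi 0) := by
  have hm : Measurable (fun s : ℝ => s^(α-1) - (1+s)^(α-1)) := by fun_prop
  rw [← Set.Ioc_union_Ioi_eq_Ioi (zero_le_one' ℝ)]
  refine IntegrableOn.union ?_ ?_
  · have h : IntegrableOn (fun s : ℝ => s^(α-1)) (Set.Ioc 0 1) :=
      (intervalIntegrable_iff_integrableOn_Ioc_of_le zero_le_one).1
        (intervalIntegral.intervalIntegrable_rpow' (by linarith))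
    refine h.mono' hm.aestronglyMeasurable ?_
    refine (ae_restrict_iff' measurableSet_Ioc).2 (ae_of_all _ fun s hs => ?_)
    have hs : 0 < s := hs.1
    have := diff_bound hα hα1.le hs
    rw [Real.norm_eq_abs, abs_of_nonneg this.1]
    have : 0 ≤ (1+s)^(α-1) := by positivity
    linarith
  · have h : IntegrableOn (fun s : ℝ => s^(α-2)) (Set.Ioi 1) := integrableOn_Ioi_rpow_of_lt (by linarith) one_pos
    refine h.mono' hm.aestronglyMeasurable ?_
    refine (ae_restrict_iff' measurableSet_Ioi).2 (ae_of_all _ fun s hs => ?_)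
    have hs : 1 < s := hs
    have hs0 : 0 < s := by linarith
    have := diff_bound hα hα1.le hs0
    rw [Real.norm_eq_abs, abs_of_nonneg this.1]
    refine this.2.trans ?_
    rw [show α - 2 = α - 1 - 1 by ring, Real.rpow_sub_one hs0.ne' (α-1)]
    gcongr
    linarith

lemma tail_int {p : ℝ → ℝ} (γ t : ℝ) (hγ : γ ≤ 0) (ht : 0 ≤ t) (hi : Integrable p) :
    IntegrableOn (fun s => (1+s)^γ * p s) (Set.Ioi t) := by
  refine hi.integrableOn.bdd_mul (c := 1) ?_ ?_
  · apply Measurable.aestronglyMeasurable; fun_prop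
  · refine (ae_restrict_iff' measurableSet_Ioi).2 (ae_of_all _ fun s hs => ?_)
    have hs : t < s := hs
    have : 0 < 1 + s := by linarith
    rw [Real.norm_eq_abs, abs_of_nonneg (by positivity)]
    exact Real.rpow_le_one_of_one_le_of_nonpos (by linarith) hγ

lemma tail_ibp {α σ r t : ℝ} (hα1 : α < 1) (hσ : σ^2 = 1) (hr : 0 < r) (ht : 0 ≤ t) (k : ℕ) (x : ℝ) :
    ∫ s in Set.Ioi t, (1+s)^(α-1) * gk (k+1) ((x - 2*σ*s)/r) =
      (σ*r/2) * ((1+t)^(α-1) * gk k ((x - 2*σ*t)/r) + (α-1) * ∫ s in Set.Ioi t, (1+s)^(α-2) * gk k ((x - 2*σ*s)/r)) := by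
  have hσ0 : σ ≠ 0 := by rintro rfl; norm_num at hσ
  obtain ⟨C, hC⟩ := gk_gd k
  obtain ⟨D, hD⟩ := gk_gd (k+1)
  have i1 := tail_int (α-1) t (by linarith) ht (aff_int hD.integrable σ r x hσ0 hr.ne')
  have i2 := tail_int (α-2) t (by linarith) ht (aff_int hC.integrable σ r x hσ0 hr.ne')
  have hd : ∀ s ∈ Set.Ici t, HasDerivAt (fun s => (1+s)^(α-1) * gk k ((x - 2*σ*s)/r))
      ((α-1) * ((1+s)^(α-2) * gk k ((x - 2*σ*s)/r)) + (-2*σ/r) * ((1+s)^(α-1) * gk (k+1) ((x - 2*σ*s)/r))) s := by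
    intro s hs
    have hs : t ≤ s := hs
    have h0 : 0 < 1 + s := by linarith
    have h1 : HasDerivAt (fun s => (x - 2*σ*s)/r) (-2*σ/r) s := by
      have := (((hasDerivAt_id s).const_mul (2*σ)).const_sub x).div_const r
      refine this.congr_deriv ?_
      ring
    have h2 := (hasDerivAt_gk k ((x - 2*σ*s)/r)).comp s h1
    have h3 : HasDerivAt (fun s : ℝ => (1+s)^(α-1)) ((α-1) * (1+s)^(α-2)) s := by
      have := ((hasDerivAt_id s).const_add 1).rpow_const (p := α-1) (Or.inl h0.ne')
      refine this.congr_deriv ?_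
      simp only [id]
      rw [show α - 1 - 1 = α - 2 by ring]; ring
    refine (h3.mul h2).congr_deriv ?_
    simp only [Function.comp]
    ring
  have hlim : Tendsto (fun s => (1+s)^(α-1) * gk k ((x - 2*σ*s)/r)) atTop (nhds 0) := by
    have h1 : Tendsto (fun s : ℝ => (1+s)^(α-1)) atTop (nhds 0) := by
      have := (tendsto_rpow_neg_atTop (show 0 < 1 - α by linarith)).comp (tendsto_atTop_add_const_left atTop 1 tendsto_id)
      refine this.congr fun s => ?_
      simp
    have h2 : Tendsto (fun s : ℝ => C * (1+s)^(α-1)) atTop (nhds 0) := by simpa using h1.const_mul C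
    refine squeeze_zero_norm' ?_ h2
    filter_upwards [eventually_ge_atTop 0] with s hs
    rw [Real.norm_eq_abs, abs_mul, abs_of_nonneg (by positivity), mul_comm]
    exact mul_le_mul_of_nonneg_right (hC.le _) (by positivity)
  have key := integral_Ioi_of_hasDerivAt_of_tendsto' hd ((i2.const_mul (α-1)).add (i1.const_mul (-2*σ/r))) hlim
  rw [integral_add (i2.const_mul (α-1)) (i1.const_mul (-2*σ/r)), integral_const_mul, integral_const_mul] at key
  set P := ∫ s in Set.Ioi t, (1+s)^(α-1) * gk (k+1) ((x - 2*σ*s)/r)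
  set Q := ∫ s in Set.Ioi t, (1+s)^(α-2) * gk k ((x - 2*σ*s)/r)
  have : (σ*r/2) * ((-2*σ/r) * P) = - P := by field_simp; linear_combination (-P) * hσ
  linear_combination this - (σ*r/2) * key

lemma split_IJ {α σ r t : ℝ} (hα : 0 < α) (hα1 : α < 1) (hσ : σ^2 = 1) (hr : 0 < r) (ht : 0 ≤ t) (k : ℕ) (x : ℝ) :
    (∫ s in Set.Ioi (0:ℝ), s^(α-1) * gk k ((x - 2*σ*s)/r)) - (∫ s in (0:ℝ)..t, (1+s)^(α-1) * gk k ((x - 2*σ*s)/r))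
     = (∫ s in Set.Ioi (0:ℝ), (s^(α-1) - (1+s)^(α-1)) * gk k ((x - 2*σ*s)/r))
       + ∫ s in Set.Ioi t, (1+s)^(α-1) * gk k ((x - 2*σ*s)/r) := by
  have hσ0 : σ ≠ 0 := by rintro rfl; norm_num at hσ
  obtain ⟨C, hC⟩ := gk_gd k
  have i0 := tail_int (α-1) 0 (by linarith) le_rfl (aff_int hC.integrable σ r x hσ0 hr.ne')
  have i1 := V_int hα hα1.le hσ0 hr.ne' k x
  have e1 : (∫ s in Set.Ioi (0:ℝ), (s^(α-1) - (1+s)^(α-1)) * gk k ((x - 2*σ*s)/r)) =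
    (∫ s in Set.Ioi (0:ℝ), s^(α-1) * gk k ((x - 2*σ*s)/r)) - ∫ s in Set.Ioi (0:ℝ), (1+s)^(α-1) * gk k ((x - 2*σ*s)/r) := by
    rw [← integral_sub i1 i0]
    congr 1; ext s; ring
  have e2 : ∫ s in Set.Ioi (0:ℝ), (1+s)^(α-1) * gk k ((x - 2*σ*s)/r) =
    (∫ s in (0:ℝ)..t, (1+s)^(α-1) * gk k ((x - 2*σ*s)/r)) + ∫ s in Set.Ioi t, (1+s)^(α-1) * gk k ((x - 2*σ*s)/r) := by
    rw [intervalIntegral.integral_of_le ht, ← setIntegral_union]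
    · rw [Set.Ioc_union_Ioi_eq_Ioi ht]
    · exact Set.Ioc_disjoint_Ioi le_rfl
    · exact measurableSet_Ioi
    · exact i0.mono_set Set.Ioc_subset_Ioi_self
    · exact i0.mono_set (Set.Ioi_subset_Ioi ht)
  rw [e1, e2]; ring

lemma tail_val {α t : ℝ} (hα1 : α < 1) (ht : 0 ≤ t) :
    IntegrableOn (fun s : ℝ => (1+s)^(α-2)) (Set.Ioi t) ∧
    ∫ s in Set.Ioi t, (1+s)^(α-2) = (1+t)^(α-1) / (1-α) := by
  have hd : ∀ s ∈ Set.Ici t, HasDerivAt (fun s : ℝ => (1+s)^(α-1)/(α-1)) ((1+s)^(α-2)) s := by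
    intro s hs
    have hs : t ≤ s := hs
    have h0 : 0 < 1 + s := by linarith
    have := (((hasDerivAt_id s).const_add 1).rpow_const (p := α-1) (Or.inl h0.ne')).div_const (α-1)
    refine this.congr_deriv ?_
    simp only [id]
    have : α - 1 ≠ 0 := by linarith
    rw [show α - 1 - 1 = α - 2 by ring]; field_simp
  have hlim : Tendsto (fun s : ℝ => (1+s)^(α-1)/(α-1)) atTop (nhds 0) := by
    have := ((tendsto_rpow_neg_atTop (show 0 < 1 - α by linarith)).comp (tendsto_atTop_add_const_left atTop 1 tendsto_id)).div_const (α-1)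
    rw [zero_div] at this
    refine this.congr fun s => ?_
    simp
  have hn : ∀ s ∈ Set.Ioi t, 0 ≤ (1+s)^(α-2) := by
    intro s hs
    have hs : t < s := hs
    have h0 : 0 < 1 + s := by linarith
    positivity
  refine ⟨integrableOn_Ioi_deriv_of_nonneg' hd hn hlim, ?_⟩
  rw [integral_Ioi_of_hasDerivAt_of_nonneg' hd hn hlim, zero_sub, ← div_neg]
  congr 1; ring

lemma Dk (α : ℝ) (hα : 0 < α) (hα1 : α ≤ 1/2) (σ : ℝ) (hσ : σ^2 = 1) (k : ℕ) : ∃ C : ℝ, 0 < C ∧ ∀ t, 0 ≤ t →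
    eLpNorm (fun x => V α σ (√(1+t)) (k+1) x - W (α-1-((k+1:ℕ)+1:ℝ)/2) σ (gk (k+1)) t x) 2 volume
      ≤ ENNReal.ofReal (C * (1+t)^(-(1/4 + (k+1:ℝ)/2))) := by
  obtain ⟨c, hc, hl2⟩ := gd_l2
  obtain ⟨K, hK, hK'⟩ := gk_gd2 k
  have hK0 := hK.nonneg
  set A0 := ∫ s in Set.Ioi (0:ℝ), (s^(α-1) - (1+s)^(α-1)) with hA0
  have hA0n : 0 ≤ A0 := setIntegral_nonneg measurableSet_Ioi fun s hs => (diff_bound hα (by linarith) hs).1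
  refine ⟨(A0 + 1) * (c * (K+1)) , by positivity, fun t ht => ?_⟩
  have hT : 0 < 1 + t := by linarith
  set r := √(1+t) with hr
  have hr0 : 0 < r := by positivity
  have hgm : ∀ j, Measurable (gk j) := fun j => (gk_cont j).measurable
  set A := fun x => ∫ s in Set.Ioi (0:ℝ), (s^(α-1) - (1+s)^(α-1)) * gk (k+1) ((x - 2*σ*s)/r) with hA
  set B := fun x => (1+t)^(α-1) * gk k ((x - 2*σ*t)/r) with hB
  set E := fun x => ∫ s in Set.Ioi t, (1+s)^(α-2) * gk k ((x - 2*σ*s)/r) with hE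
  have mFA : Measurable (Function.uncurry fun s x : ℝ => (s^(α-1) - (1+s)^(α-1)) * gk (k+1) ((x - 2*σ*s)/r)) := by
    have := hgm (k+1)
    unfold Function.uncurry; fun_prop
  have mFE : Measurable (Function.uncurry fun s x : ℝ => (1+s)^(α-2) * gk k ((x - 2*σ*s)/r)) := by
    have := hgm k
    unfold Function.uncurry; fun_prop
  have mB : Measurable B := by
    have := hgm k
    fun_prop
  have bA : eLpNorm A 2 volume ≤ ENNReal.ofReal (A0 * (c * K * r^(1/2:ℝ))) := by
    rw [hA0, ← integral_mul_const]
    refine mink_set _ mFA _ _ measurableSet_Ioi ((diff_int hα (by linarith)).mul_const _) ?_ ?_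
    · intro s hs
      have := (diff_bound hα (by linarith) hs).1
      positivity
    · intro s hs
      have h1 := (diff_bound hα (by linarith : α ≤ 1) hs).1
      have := eLpNorm_cmul_le (s^(α-1) - (1+s)^(α-1)) _ _ (hl2 K _ hK' r (2*σ*s) hr0)
      rwa [abs_of_nonneg h1] at this
  have bB : eLpNorm B 2 volume ≤ ENNReal.ofReal ((1+t)^(α-1) * (c * K * r^(1/2:ℝ))) := by
    have := eLpNorm_cmul_le ((1+t)^(α-1)) _ _ (hl2 K _ hK r (2*σ*t) hr0)
    rwa [abs_of_nonneg (by positivity)] at this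
  obtain ⟨tv1, tv2⟩ := tail_val (show α < 1 by linarith) ht
  have bE : eLpNorm E 2 volume ≤ ENNReal.ofReal ((1+t)^(α-1)/(1-α) * (c * K * r^(1/2:ℝ))) := by
    rw [← tv2, ← integral_mul_const]
    refine mink_set _ mFE _ _ measurableSet_Ioi (tv1.mul_const _) ?_ ?_
    · intro s hs
      have hs : t < s := hs
      have : 0 < 1 + s := by linarith
      positivity
    · intro s hs
      have hs : t < s := hs
      have : 0 < 1 + s := by linarith
      have := eLpNorm_cmul_le ((1+s)^(α-2)) _ _ (hl2 K _ hK r (2*σ*s) hr0)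
      rwa [abs_of_nonneg (by positivity)] at this
  have hα' : 0 < 1 - α := by linarith
  have e : (fun x => V α σ r (k+1) x - W (α-1-((k+1:ℕ)+1:ℝ)/2) σ (gk (k+1)) t x)
      = fun x => (r^(k+1+1))⁻¹ * (A x + (σ*r/2) * (B x + (α-1) * E x)) := by
    ext x
    rw [W_gauss α σ t x (k+1) ht _ rfl, ← hr, V, ← mul_sub, split_IJ hα (by linarith) hσ hr0 ht,
      tail_ibp (by linarith) hσ hr0 ht]
  rw [e]
  have mE := meas_set _ mFE (Set.Ioi t)
  have mA := meas_set _ mFA (Set.Ioi 0)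
  have b1 := eLpNorm_add_le' mB.aestronglyMeasurable (mE.const_mul (α-1)) (by positivity) (by positivity)
    bB (eLpNorm_cmul_le (α-1) _ _ bE)
  have b2 := eLpNorm_add_le' mA ((mB.aestronglyMeasurable.add (mE.const_mul (α-1))).const_mul (σ*r/2)) (by positivity) (by positivity)
    bA (eLpNorm_cmul_le (σ*r/2) _ _ b1)
  have b3 := eLpNorm_cmul_le (r^(k+1+1))⁻¹ _ _ b2
  refine b3.trans (ENNReal.ofReal_le_ofReal ?_)
  have hσ1 : |σ| = 1 := by
    rw [← sq_abs] at hσ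
    nlinarith [abs_nonneg σ]
  rw [abs_of_nonneg (by positivity), abs_of_neg (show α - 1 < 0 by linarith), abs_div, abs_mul, hσ1, abs_of_pos hr0, abs_two]
  have e1 : r * (1+t)^(α-1) ≤ 1 := by
    rw [hr, Real.sqrt_eq_rpow, ← Real.rpow_add hT]
    exact Real.rpow_le_one_of_one_le_of_nonpos (by linarith) (by linarith)
  have e2 : (r^(k+1+1))⁻¹ * r^(1/2:ℝ) = (1+t)^(-(1/4 + (k+1:ℝ)/2)) := by
    rw [hr, pow_sqrt _ hT.le, ← Real.rpow_neg hT.le, Real.sqrt_eq_rpow, ← Real.rpow_mul hT.le, ← Real.rpow_add hT]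
    congr 1; push_cast; ring
  rw [← e2]
  have e3 : (r^(k+1+1))⁻¹ * (A0 * (c * K * r^(1/2:ℝ)) + 1*r/2 * ((1+t)^(α-1) * (c * K * r^(1/2:ℝ)) +
      -(α-1) * ((1+t)^(α-1)/(1-α) * (c * K * r^(1/2:ℝ)))))
      = (A0 + r * (1+t)^(α-1)) * (c * K) * ((r^(k+1+1))⁻¹ * r^(1/2:ℝ)) := by
    field_simp
    ring
  rw [e3]
  gcongr
  linarith


lemma W_meas (χ : ℝ → ℝ) (hχ : Continuous χ) (γ σ t : ℝ) (ht : 0 ≤ t) :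
    AEStronglyMeasurable (W γ σ χ t) volume := by
  refine meas_int (fun s x => (1+s)^γ * U 0 (√(t-s)) (√(1+s)) χ (x - 2*σ*s)) ?_ t ht
  have a1 : Measurable (fun q : ℝ × ℝ => (1+q.1)^γ) := by fun_prop
  exact a1.mul (U_meas 0 χ hχ (fun s => √(t-s)) (fun s => √(1+s)) (fun s => 2*σ*s) (by fun_prop) (by fun_prop) (by fun_prop))

lemma U_lin {K L : ℝ} {p q : ℝ → ℝ} (hp : Gd K p) (hq : Gd L q) (M : ℝ) (j : ℕ) (a l x : ℝ) :
    U j a l (fun y => M * p y + q y) x = M * U j a l p x + U j a l q x := by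
  unfold U
  have i1 : Integrable (fun ρ => M * (gk j ρ * p ((x - a*ρ)/l))) := (U_integrable hp j a l x).const_mul M
  have i2 : Integrable (fun ρ => gk j ρ * q ((x - a*ρ)/l)) := U_integrable hq j a l x
  rw [← integral_const_mul, ← integral_add i1 i2]
  congr 1; ext ρ; ring

lemma W_lin {K L : ℝ} {p q : ℝ → ℝ} (hp : Gd K p) (hq : Gd L q) (M γ σ t x : ℝ) (ht : 0 ≤ t) :
    W γ σ (fun y => M * p y + q y) t x = M * W γ σ p t x + W γ σ q t x := by
  unfold W
  rw [← intervalIntegral.integral_const_mul,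
    ← intervalIntegral.integral_add ((W_ii hp γ σ t x ht).const_mul M) (W_ii hq γ σ t x ht)]
  congr 1; ext s
  rw [U_lin hp hq]; ring

lemma finL (α : ℝ) (hα : 0 < α) (hα1 : α ≤ 1/2) (σ : ℝ) (hσ : σ = 1 ∨ σ = -1) (k : ℕ) :
    ∃ C : ℝ, 0 < C ∧ ∀ K X Y, Chain K (k+1+1) X → Chain K (k+1) Y → Gd K (fun y => y * X (k+1+1) y) →
      (∀ y, Y (k+1) y = (α - 1 - (k+1:ℕ)/2) * X (k+1) y - y * X (k+1+1) y / 2) → ∀ M, |M| ≤ K → ∀ t, 0 ≤ t →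
      ∀ γ e : ℝ, γ = α - 1 - (k+1:ℝ)/2 - 1/2 → e = -(1/4 + (k+1:ℝ)/2) →
      eLpNorm (fun x => W γ σ (fun y => M * gk (k+1) y + X (k+1+1) y) t x - M * V α σ (√(1+t)) (k+1) x) 2 volume
        ≤ ENNReal.ofReal (C * K * log (2+t) * (1+t)^e) := by
  have hσ2 : σ^2 = 1 := by rcases hσ with rfl | rfl <;> norm_num
  have hσ0 : σ ≠ 0 := by rcases hσ with rfl | rfl <;> norm_num
  obtain ⟨C1, hC1, h1⟩ := mainL α hα1 σ hσ (k+1)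
  obtain ⟨C2, hC2, h2⟩ := Dk α hα hα1 σ hσ2 k
  refine ⟨C1 + 2*C2, by positivity, ?_⟩
  rintro K X Y hX hY hy hYe M hM t ht γ e rfl rfl
  have hT : 0 < 1 + t := by linarith
  have hXg := hX.gd (k+1+1) le_rfl
  have hK := hXg.nonneg
  obtain ⟨G, hG⟩ := gk_gd (k+1)
  set P := (1+t)^(-(1/4 + (k+1:ℝ)/2)) with hP
  have hP0 : 0 < P := by positivity
  have hlog : 1 ≤ 2 * log (2+t) := by
    have : log 2 ≤ log (2+t) := Real.log_le_log two_pos (by linarith)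
    have := Real.log_two_gt_d9
    linarith
  have b1 := h1 K X Y hX hY hy hYe t ht
  have b2 := h2 t ht
  have e1 : (fun x => W (α - 1 - (k+1:ℝ)/2 - 1/2) σ (fun y => M * gk (k+1) y + X (k+1+1) y) t x - M * V α σ (√(1+t)) (k+1) x)
      = fun x => W (α - 1 - (k+1:ℝ)/2 - 1/2) σ (X (k+1+1)) t x -
        M * (V α σ (√(1+t)) (k+1) x - W (α-1-((k+1:ℕ)+1:ℝ)/2) σ (gk (k+1)) t x) := by
    ext x
    rw [W_lin hG hXg _ _ _ _ _ ht, show α-1-((k+1:ℕ)+1:ℝ)/2 = α - 1 - (k+1:ℝ)/2 - 1/2 by push_cast; ring]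
    ring
  rw [e1]
  have mV : Continuous (V α σ (√(1+t)) (k+1)) := continuous_iff_continuousAt.2 fun x =>
    (V_deriv hα (by linarith) hσ0 (by positivity) (k+1) x).continuousAt
  have b3 : eLpNorm (W (α - 1 - (k+1:ℝ)/2 - 1/2) σ (X (k+1+1)) t) 2 volume ≤ ENNReal.ofReal (C1 * K * log (2+t) * P) := by
    push_cast at b1
    exact b1
  refine (eLpNorm_sub_le' (W_meas _ hXg.1 _ σ t ht)
    ((mV.aestronglyMeasurable.sub (W_meas _ (gk_cont (k+1)) _ σ t ht)).const_mul M) ?_ ?_ b3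
    (eLpNorm_cmul_le M _ _ b2)).trans (ENNReal.ofReal_le_ofReal ?_)
  · have : 0 ≤ log (2+t) := by linarith
    positivity
  · positivity
  · have : |M| * (C2 * P) ≤ K * (C2 * P) * (2 * log (2+t)) := by
      calc _ ≤ K * (C2 * P) * 1 := by rw [mul_one]; gcongr
        _ ≤ _ := by gcongr
    nlinarith

def E8 (K : ℝ) (p : ℝ → ℝ) : Prop := Continuous p ∧ ∀ x, |p x| ≤ K * exp (-x^2/8)

lemma E8.nonneg {K : ℝ} {p : ℝ → ℝ} (h : E8 K p) : 0 ≤ K := by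
  have := (abs_nonneg _).trans (h.2 0)
  simpa using this

lemma E8.gd {K : ℝ} {p : ℝ → ℝ} (h : E8 K p) : Gd K p := by
  refine ⟨h.1, fun x => (h.2 x).trans ?_⟩
  apply mul_le_mul_of_nonneg_left _ h.nonneg
  apply exp_le_exp.2
  nlinarith [sq_nonneg x]

lemma E8.gd_mul {K : ℝ} {p : ℝ → ℝ} (h : E8 K p) : Gd (4*K) (fun y => y * p y) := by
  refine ⟨continuous_id.mul h.1, fun x => ?_⟩
  rw [abs_mul]
  have h0 := h.nonneg
  have h1 : |x| ≤ 4 * exp (x^2/16) := by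
    have := Real.add_one_le_exp (x^2/16)
    rw [← sq_abs] at this ⊢
    nlinarith [sq_nonneg (|x| - 2)]
  calc |x| * |p x| ≤ (4 * exp (x^2/16)) * (K * exp (-x^2/8)) := by
        gcongr; exact h.2 x
    _ = 4 * K * (exp (x^2/16) * exp (-x^2/8)) := by ring
    _ = _ := by rw [← exp_add]; congr 2; ring

lemma E8.prim : ∃ c : ℝ, 0 < c ∧ ∀ K p, E8 K p → (∫ x, p x = 0) → Gd (c*K) (fun x => ∫ y in Set.Iic x, p y) ∧
    ∀ x, HasDerivAt (fun x => ∫ y in Set.Iic x, p y) (p x) x := by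
  have hi := integrable_g16
  refine ⟨(∫ y : ℝ, exp (-y^2/16)) + 1, ?_, fun K p h h0 => ?_⟩
  · have : 0 ≤ ∫ y : ℝ, exp (-y^2/16) := integral_nonneg fun y => (exp_pos _).le
    linarith
  have hK := h.nonneg
  have hp := h.gd.integrable
  have hd : ∀ x, HasDerivAt (fun x => ∫ y in Set.Iic x, p y) (p x) x := by
    intro x
    have e : (fun x => ∫ y in Set.Iic x, p y) = fun x => (∫ y in Set.Iic 0, p y) + ∫ y in (0:ℝ)..x, p y := by
      ext z
      have := intervalIntegral.integral_Iic_sub_Iic (hp.integrableOn (s := Set.Iic 0)) (hp.integrableOn (s := Set.Iic z))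
      linarith
    rw [e]
    exact (intervalIntegral.integral_hasDerivAt_right (hp.intervalIntegrable)
      (h.1.stronglyMeasurableAtFilter _ _) h.1.continuousAt).const_add _
  refine ⟨⟨continuous_iff_continuousAt.2 fun x => (hd x).continuousAt, fun x => ?_⟩, hd⟩
  have gen : ∀ S : Set ℝ, MeasurableSet S → (∀ y ∈ S, x^2 ≤ y^2) →
      |∫ y in S, p y| ≤ ((∫ y : ℝ, exp (-y^2/16)) + 1) * K * exp (-x^2/16) := by
    intro S hS hy
    calc |∫ y in S, p y| ≤ ∫ y in S, |p y| := abs_integral_le_integral_abs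
      _ ≤ ∫ y in S, K * exp (-x^2/16) * exp (-y^2/16) := by
          refine setIntegral_mono_on hp.abs.integrableOn (hi.const_mul _).integrableOn hS fun y hyS => ?_
          refine (h.2 y).trans ?_
          rw [mul_assoc, ← exp_add]
          apply mul_le_mul_of_nonneg_left _ hK
          apply exp_le_exp.2
          have := hy y hyS
          linarith
      _ ≤ ∫ y, K * exp (-x^2/16) * exp (-y^2/16) :=
          setIntegral_le_integral (hi.const_mul _) (ae_of_all _ fun y => by positivity)
      _ = K * exp (-x^2/16) * ∫ y : ℝ, exp (-y^2/16) := integral_const_mul _ _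
      _ ≤ _ := by
          have : 0 ≤ K * exp (-x^2/16) := by positivity
          nlinarith
  rcases le_total x 0 with hx | hx
  · refine gen _ measurableSet_Iic fun y hy => ?_
    have hy : y ≤ x := hy
    nlinarith
  · have e : ∫ y in Set.Iic x, p y = - ∫ y in Set.Ioi x, p y := by
      have := intervalIntegral.integral_Iic_add_Ioi (hp.integrableOn (s := Set.Iic x)) (hp.integrableOn (s := Set.Ioi x))
      linarith
    simp only
    rw [e, abs_neg]
    refine gen _ measurableSet_Ioi fun y hy => ?_
    have hy : x < y := hy
    nlinarith

lemma gk_e8 (j : ℕ) : ∃ C : ℝ, E8 C (gk j) := by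
  obtain ⟨C, hC, h⟩ := poly_bound (gpoly j)
  refine ⟨C / √(4*π), gk_cont j, fun x => ?_⟩
  rw [gk, abs_mul, abs_of_pos (a := exp (-x^2/4) / √(4*π)) (by positivity)]
  calc _ ≤ C * exp (x^2/8) * (exp (-x^2/4) / √(4*π)) := by gcongr; exact h x
    _ = C / √(4*π) * (exp (x^2/8) * exp (-x^2/4)) := by ring
    _ = _ := by
      rw [← exp_add]
      congr 2; ring

lemma gk_int : ∫ x, gk 0 x = 1 := by
  simp_rw [gk_zero]
  rw [integral_div, show (fun x : ℝ => exp (-x^2/4)) = fun x => exp (-(1/4) * x^2) by ext; congr 1; ring, integral_gaussian]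
  rw [show π / (1/4) = 4*π by ring, div_self]
  positivity

lemma E8.mono {K L : ℝ} {p : ℝ → ℝ} (h : E8 K p) (hL : K ≤ L) : E8 L p :=
  ⟨h.1, fun x => (h.2 x).trans (mul_le_mul_of_nonneg_right hL (exp_pos _).le)⟩

lemma E8.comb {K L : ℝ} {p q : ℝ → ℝ} (h : E8 K p) (hq : E8 L q) (M : ℝ) : E8 (K + |M| * L) (fun x => p x - M * q x) := by
  refine ⟨h.1.sub (continuous_const.mul hq.1), fun x => ?_⟩
  have h1 := h.2 x
  have h2 := hq.2 x
  calc |p x - M * q x| ≤ |p x| + |M * q x| := abs_sub _ _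
    _ ≤ K * exp (-x^2/8) + |M| * (L * exp (-x^2/8)) := by
      rw [abs_mul]; gcongr
    _ = _ := by ring


def Xc (Ψ p0 p1 p2 : ℝ → ℝ) : ℕ → ℝ → ℝ
  | 0 => Ψ
  | 1 => p0
  | 2 => p1
  | 3 => p2
  | _ => fun _ => 0

noncomputable def Yc (α : ℝ) (Ψ p0 p1 p2 : ℝ → ℝ) : ℕ → ℝ → ℝ
  | 0 => fun y => (α-1) * Ψ y + (-1/2) * (y * p0 y)
  | 1 => fun y => (α-3/2) * p0 y + (-1/2) * (y * p1 y)
  | 2 => fun y => (α-2) * p1 y + (-1/2) * (y * p2 y)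
  | _ => fun _ => 0

lemma Yder {p q r : ℝ → ℝ} (c d : ℝ) (hcd : d = c - 1/2) (h1 : ∀ x, HasDerivAt p (q x) x) (h2 : ∀ x, HasDerivAt q (r x) x) (x : ℝ) :
    HasDerivAt (fun y => c * p y + (-1/2) * (y * q y)) (d * q x + (-1/2) * (x * r x)) x := by
  have := ((h1 x).const_mul c).add (((hasDerivAt_id x).mul (h2 x)).const_mul (-1/2))
  refine this.congr_deriv ?_
  simp only [id, hcd]; ring

lemma Ygd {A B K c : ℝ} {p q : ℝ → ℝ} (hp : Gd A p) (hq : Gd B (fun y => y * q y)) (hK : |c| * A + 1/2 * B ≤ K) :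
    Gd K (fun y => c * p y + (-1/2) * (y * q y)) := by
  refine ((hp.smul c).add (hq.smul (-1/2))).mono ?_
  rwa [show |(-1/2:ℝ)| = 1/2 by rw [abs_of_neg] <;> norm_num]

theorem stmt_16 (n : ℕ) (hn : 1 ≤ n) (σ : ℝ) (hσ : σ = 1 ∨ σ = -1) :
    ∃ C : ℝ, 0 < C ∧
      ∀ f : ℝ → ℝ, ContDiff ℝ 2 f →
        ∀ Mf : ℝ,
          (∀ m : ℕ, m ≤ 2 → ∀ x : ℝ, Real.exp (x^2/8) * |iteratedDeriv m f x| ≤ Mf) →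
          ∀ t : ℝ, 0 ≤ t →
            eLpNorm (fun x : ℝ =>
                duhamel (forcing n σ f) x t - (∫ x' : ℝ, f x') * selfSimU n σ x t) 2 volume
              ≤ ENNReal.ofReal (C * Mf * Real.log (2 + t) * (1 + t) ^ (-(3:ℝ)/4)) ∧
            eLpNorm (fun x : ℝ =>
                deriv (fun x' => duhamel (forcing n σ f) x' t) x
                  - (∫ x' : ℝ, f x') * deriv (fun x' => selfSimU n σ x' t) x) 2 volume
              ≤ ENNReal.ofReal (C * Mf * Real.log (2 + t) * (1 + t) ^ (-(5:ℝ)/4)) := by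
  have hσ2 : σ^2 = 1 := by rcases hσ with rfl | rfl <;> norm_num
  have hσ0 : σ ≠ 0 := by rcases hσ with rfl | rfl <;> norm_num
  set α := (2:ℝ)^(-(n:ℝ)) with hαdef
  have hα : 0 < α := by positivity
  have hα1 : α ≤ 1/2 := by
    have : (2:ℝ)^(-(n:ℝ)) ≤ 2^(-1:ℝ) := by
      apply Real.rpow_le_rpow_of_exponent_le one_le_two
      have : (1:ℝ) ≤ n := by exact_mod_cast hn
      linarith
    rw [Real.rpow_neg_one] at this
    rw [hαdef]; linarith
  obtain ⟨C1, hC1, F1⟩ := finL α hα hα1 σ hσ 0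
  obtain ⟨C2, hC2, F2⟩ := finL α hα hα1 σ hσ 1
  obtain ⟨c, hc, hprim⟩ := E8.prim
  obtain ⟨G0, hG0⟩ := gk_e8 0
  obtain ⟨G1, hG1⟩ := gk_e8 1
  obtain ⟨G2, hG2⟩ := gk_e8 2
  have i8 : Integrable (fun x : ℝ => exp (-x^2/8)) := by
    have := integrable_exp_neg_mul_sq (b := 1/8) (by norm_num)
    refine this.congr (ae_of_all _ fun w => ?_)
    simp only; congr 1; ring
  set cM := ∫ x : ℝ, exp (-x^2/8) with hcM
  have hcM0 : 0 ≤ cM := integral_nonneg fun y => (exp_pos _).le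
  have n0 := hG0.nonneg
  have n1 := hG1.nonneg
  have n2 := hG2.nonneg
  set G := G0 + G1 + G2 with hG
  set D := (2*c+4) * (1 + cM * G) + cM with hD
  have hD0 : 0 < D := by positivity
  refine ⟨(C1 + C2) * D, by positivity, ?_⟩
  intro f hf Mf hMf t ht
  have hT : 0 < 1 + t := by linarith
  set f1 := deriv f with hf1
  set f2 := deriv f1 with hf2
  have hder0 : ∀ x, HasDerivAt f (f1 x) x := fun x => (hf.differentiable (by norm_num) x).hasDerivAt
  have hc1 : ContDiff ℝ 1 f1 := by
    have : ContDiff ℝ (1+1) f := by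
      rw [one_add_one_eq_two]; exact hf
    exact (contDiff_succ_iff_deriv.1 this).2.2
  have hder1 : ∀ x, HasDerivAt f1 (f2 x) x := fun x => (hc1.differentiable (by norm_num) x).hasDerivAt
  have hc2 : Continuous f2 := hc1.continuous_deriv (by norm_num)
  have conv : ∀ m ≤ 2, ∀ x, |iteratedDeriv m f x| ≤ Mf * exp (-x^2/8) := by
    intro m hm x
    have := hMf m hm x
    rw [show -x^2/8 = -(x^2/8) by ring, exp_neg, ← div_eq_mul_inv, le_div_iff₀ (exp_pos _), mul_comm]
    exact this
  have E0 : E8 Mf f := ⟨hf.continuous, fun x => by simpa using conv 0 (by norm_num) x⟩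
  have E1 : E8 Mf f1 := ⟨hc1.continuous, fun x => by simpa using conv 1 (by norm_num) x⟩
  have E2 : E8 Mf f2 := ⟨hc2, fun x => by
    have := conv 2 le_rfl x
    rwa [iteratedDeriv_succ, iteratedDeriv_one] at this⟩
  have hM0 := E0.nonneg
  set M := ∫ x, f x with hM
  have hMb : |M| ≤ cM * Mf := by
    calc |M| ≤ ∫ x, |f x| := abs_integral_le_integral_abs
      _ ≤ ∫ x : ℝ, Mf * exp (-x^2/8) := integral_mono E0.gd.integrable.abs (i8.const_mul _) E0.2
      _ = _ := by rw [integral_const_mul, mul_comm]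
  set K0 := (1 + cM * G) * Mf with hK0
  have hle : ∀ g, 0 ≤ g → g ≤ G → Mf + |M| * g ≤ K0 := by
    intro g hg hgG
    have : |M| * g ≤ cM * Mf * G := mul_le_mul hMb hgG hg (by positivity)
    rw [hK0]; linarith
  set p0 := fun x => f x - M * gk 0 x with hp0
  set p1 := fun x => f1 x - M * gk 1 x with hp1
  set p2 := fun x => f2 x - M * gk 2 x with hp2
  have e0 : E8 K0 p0 := (E0.comb hG0 M).mono (hle _ n0 (by linarith))
  have e1 : E8 K0 p1 := (E1.comb hG1 M).mono (hle _ n1 (by linarith))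
  have e2 : E8 K0 p2 := (E2.comb hG2 M).mono (hle _ n2 (by linarith))
  have d0 : ∀ x, HasDerivAt p0 (p1 x) x := fun x => (hder0 x).sub ((hasDerivAt_gk 0 x).const_mul M)
  have d1 : ∀ x, HasDerivAt p1 (p2 x) x := fun x => (hder1 x).sub ((hasDerivAt_gk 1 x).const_mul M)
  have hz : ∫ x, p0 x = 0 := by
    rw [hp0, integral_sub E0.gd.integrable (hG0.gd.integrable.const_mul M), integral_const_mul, gk_int]
    linarith
  obtain ⟨gΨ, dΨ⟩ := hprim K0 p0 e0 hz
  set Ψ := fun x => ∫ y in Set.Iic x, p0 y with hΨ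
  have hK00 := e0.nonneg
  set K := D * Mf with hK
  have hKK : (2*c+4) * K0 ≤ K := by
    rw [hK, hD, hK0]; nlinarith [mul_nonneg hcM0 hM0]
  have hMK : |M| ≤ K := by
    refine hMb.trans ?_
    rw [hK, hD]
    have : 0 ≤ (2*c+4) * (1 + cM * G) * Mf := by positivity
    linarith
  have hcK : 0 ≤ c * K0 := by positivity
  have k1 : c * K0 ≤ K := by linarith
  have k2 : K0 ≤ K := by linarith
  have k3 : 4 * K0 ≤ K := by linarith
  have X3 : Chain K 3 (Xc Ψ p0 p1 p2) := by
    constructor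
    · intro i hi
      interval_cases i
      · exact gΨ.mono k1
      · exact e0.gd.mono k2
      · exact e1.gd.mono k2
      · exact e2.gd.mono k2
    · intro i hi
      interval_cases i
      · exact dΨ
      · exact d0
      · exact d1
  have Y2 : Chain K 2 (Yc α Ψ p0 p1 p2) := by
    constructor
    · intro i hi
      interval_cases i
      · refine Ygd gΨ e0.gd_mul ?_
        have : |α-1| ≤ 1 := by rw [abs_le]; constructor <;> linarith
        have : |α-1| * (c * K0) ≤ 1 * (c*K0) := mul_le_mul_of_nonneg_right this hcK
        linarith
      · refine Ygd e0.gd e1.gd_mul ?_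
        have : |α-3/2| ≤ 2 := by rw [abs_le]; constructor <;> linarith
        have : |α-3/2| * K0 ≤ 2 * K0 := mul_le_mul_of_nonneg_right this hK00
        linarith
      · refine Ygd e1.gd e2.gd_mul ?_
        have : |α-2| ≤ 2 := by rw [abs_le]; constructor <;> linarith
        have : |α-2| * K0 ≤ 2 * K0 := mul_le_mul_of_nonneg_right this hK00
        linarith
    · intro i hi
      interval_cases i
      · exact Yder (α-1) (α-3/2) (by ring) dΨ d0
      · exact Yder (α-3/2) (α-2) (by ring) d0 d1
  have r1 := F1 K _ _ X3.pred Y2.pred (e1.gd_mul.mono k3) (fun y => by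
    simp only [Xc, Yc]; push_cast; ring) M hMK t ht (α-2) (-3/4) (by norm_num; ring) (by norm_num)
  have r2 := F2 K _ _ X3 Y2 (e2.gd_mul.mono k3) (fun y => by
    simp only [Xc, Yc]; push_cast; ring) M hMK t ht (α-2-1/2) (-5/4) (by norm_num; ring) (by norm_num)
  have q1 : (fun y => M * gk (0+1) y + Xc Ψ p0 p1 p2 (0+1+1) y) = f1 := by
    ext y; simp [Xc, hp1]
  have q2 : (fun y => M * gk (1+1) y + Xc Ψ p0 p1 p2 (1+1+1) y) = f2 := by
    ext y; simp [Xc, hp2]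
  rw [q1] at r1
  rw [q2] at r2
  have du : (fun x' => duhamel (forcing n σ f) x' t) = W (α-2) σ f1 t := by
    ext x; exact duhamel_eq E0.gd E1.gd hder0 n σ t x ht
  have ds : (fun x' => selfSimU n σ x' t) = V α σ (√(1+t)) 1 := by
    ext x; exact selfSim_eq n σ hσ2 t x ht
  have hlog : 0 ≤ log (2+t) := Real.log_nonneg (by linarith)
  constructor
  · have : (fun x : ℝ => duhamel (forcing n σ f) x t - M * selfSimU n σ x t)
        = fun x => W (α-2) σ f1 t x - M * V α σ (√(1+t)) (0+1) x := by
      ext x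
      rw [← du, show V α σ (√(1+t)) (0+1) x = selfSimU n σ x t from (congrFun ds x).symm]
    rw [this]
    refine r1.trans (ENNReal.ofReal_le_ofReal ?_)
    have : C1 * K ≤ (C1 + C2) * D * Mf := by
      rw [hK]
      have : 0 ≤ C2 * D * Mf := by positivity
      linarith
    have hp : 0 ≤ log (2+t) * (1+t)^(-3/4:ℝ) := by positivity
    have := mul_le_mul_of_nonneg_right this hp
    linarith
  · have : (fun x : ℝ => deriv (fun x' => duhamel (forcing n σ f) x' t) x
                  - M * deriv (fun x' => selfSimU n σ x' t) x)
        = fun x => W (α-2-1/2) σ f2 t x - M * V α σ (√(1+t)) (1+1) x := by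
      ext x
      rw [du, ds, (W_deriv E1.gd E2.gd hder1 (α-2) σ t ht x).deriv,
        (V_deriv hα (by linarith) hσ0 (by positivity) 1 x).deriv]
    rw [this]
    refine r2.trans (ENNReal.ofReal_le_ofReal ?_)
    have : C2 * K ≤ (C1 + C2) * D * Mf := by
      rw [hK]
      have : 0 ≤ C1 * D * Mf := by positivity
      linarith
    have hp : 0 ≤ log (2+t) * (1+t)^(-5/4:ℝ) := by positivity
    have := mul_le_mul_of_nonneg_right this hp
    linarith
end

section
/- Fix an integer n ≥ 1 and set a = 2^{-n}. For every real k > 0, the Fourier transform of f_n satisfies ∫_{-∞}^{∞} e^{-ikz} f_n(z) dz = −i · 2^{1+a} · 2√π · k^{1-a} e^{-k²} · J_{n,∞}, where J_{n,∞} = lim_{z→∞} ∫_0^z e^{2is} s^{a-1} ds. -/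
open MeasureTheory Real Filter

namespace S19

lemma shift_int {φ w : ℝ → ℝ} (hc : Continuous φ) (hφ : Integrable φ) (μ : Measure ℝ) [SFinite μ]
    (hw : Integrable w μ) :
    Integrable (fun p : ℝ × ℝ => φ (p.1 + p.2) * w p.2) ((volume : Measure ℝ).prod μ) := by
  have hm : AEStronglyMeasurable (fun p : ℝ × ℝ => φ (p.1 + p.2) * w p.2)
      ((volume : Measure ℝ).prod μ) := by
    apply AEStronglyMeasurable.mul
    · exact (hc.comp (continuous_fst.add continuous_snd)).aestronglyMeasurable
    · exact hw.aestronglyMeasurable.comp_snd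
  rw [integrable_prod_iff' hm]
  constructor
  · filter_upwards with y
    exact (hφ.comp_add_right y).mul_const _
  · have : (fun y => ∫ x, ‖φ (x + y) * w y‖) = fun y => (∫ x, ‖φ x‖) * ‖w y‖ := by
      ext y
      simp_rw [norm_mul]
      rw [integral_mul_const, integral_add_right_eq_self (fun x => ‖φ x‖)]
    simp only [this]
    exact hw.norm.const_mul _

lemma L1_bound {φ w : ℝ → ℝ} (hc : Continuous φ) (hφ : Integrable φ) (μ : Measure ℝ) [SFinite μ]
    (hw : Integrable w μ) :
    ∫ z, |∫ t, φ (z + t) * w t ∂μ| ≤ (∫ x, |φ x|) * ∫ t, |w t| ∂μ := by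
  have h := shift_int hc hφ μ hw
  have h2 := h.norm
  calc ∫ z, |∫ t, φ (z + t) * w t ∂μ| ≤ ∫ z, ∫ t, |φ (z + t) * w t| ∂μ := by
        apply integral_mono h.integral_prod_left.norm h2.integral_prod_left
        intro z
        exact norm_integral_le_integral_norm _
    _ = ∫ t, (∫ z, |φ (z + t) * w t|) ∂μ := integral_integral_swap h2
    _ = _ := by
        simp_rw [abs_mul]
        rw [← integral_const_mul]
        congr 1
        ext t
        rw [integral_mul_const, integral_add_right_eq_self (fun x => |φ x|)]

lemma phase_norm (k z : ℝ) : ‖Complex.exp (-Complex.I * (k:ℂ) * (z:ℂ))‖ = 1 := by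
  have : -Complex.I * (k:ℂ) * (z:ℂ) = ((-(k*z) : ℝ) : ℂ) * Complex.I := by push_cast; ring
  rw [this, Complex.norm_exp_ofReal_mul_I]

lemma phase_int (k : ℝ) {f : ℝ → ℝ} (hf : Integrable f) :
    Integrable (fun z : ℝ => Complex.exp (-Complex.I * (k:ℂ) * (z:ℂ)) * (f z : ℂ)) := by
  apply hf.ofReal.bdd_mul (c := 1)
  · exact (by fun_prop : Continuous fun z : ℝ =>
      Complex.exp (-Complex.I * (k:ℂ) * (z:ℂ))).aestronglyMeasurable
  · filter_upwards with z
    exact (phase_norm k z).le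

lemma phase_conv (k : ℝ) {φ w : ℝ → ℝ} (hc : Continuous φ) (hφ : Integrable φ) (μ : Measure ℝ)
    [SFinite μ] (hw : Integrable w μ) :
    ∫ z : ℝ, Complex.exp (-Complex.I * (k:ℂ) * (z:ℂ)) * ((∫ t, φ (z + t) * w t ∂μ : ℝ) : ℂ) =
    (∫ x : ℝ, Complex.exp (-Complex.I * (k:ℂ) * (x:ℂ)) * (φ x : ℂ)) *
      ∫ t : ℝ, Complex.exp (Complex.I * (k:ℂ) * (t:ℂ)) * (w t : ℂ) ∂μ := by
  have h := shift_int hc hφ μ hw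
  have h2 : Integrable (fun p : ℝ × ℝ => Complex.exp (-Complex.I * (k:ℂ) * (p.1:ℂ)) *
      ((φ (p.1 + p.2) * w p.2 : ℝ) : ℂ)) ((volume : Measure ℝ).prod μ) := by
    apply h.ofReal.bdd_mul (c := 1)
    · exact (by fun_prop : Continuous fun z : ℝ × ℝ =>
        Complex.exp (-Complex.I * (k:ℂ) * (z.1:ℂ))).aestronglyMeasurable
    · filter_upwards with z
      exact (phase_norm k z.1).le
  simp_rw [← integral_complex_ofReal, ← integral_const_mul]
  rw [integral_integral_swap h2]
  congr 1
  ext t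
  rw [← integral_add_right_eq_self (fun x : ℝ => Complex.exp (-Complex.I * (k:ℂ) * (x:ℂ)) * (φ x : ℂ)) t,
    ← integral_mul_const]
  congr 1
  ext z
  have : Complex.exp (-Complex.I * (k:ℂ) * (z:ℂ)) =
    Complex.exp (-Complex.I * (k:ℂ) * ((z + t : ℝ):ℂ)) * Complex.exp (Complex.I * (k:ℂ) * (t:ℂ)) := by
    rw [← Complex.exp_add]; congr 1; push_cast; ring
  rw [this]
  push_cast
  ring

noncomputable def G (x : ℝ) : ℝ := Real.exp (-x^2/4)
noncomputable def g (x : ℝ) : ℝ := x * Real.exp (-x^2/4)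

lemma G_cont : Continuous G := by unfold G; fun_prop
lemma g_cont : Continuous g := by unfold g; fun_prop
lemma G_int : Integrable G := by
  convert integrable_exp_neg_mul_sq (b := 1/4) (by norm_num) using 2 with x
  unfold G; congr 1; ring
lemma g_int : Integrable g := by
  convert integrable_mul_exp_neg_mul_sq (b := 1/4) (by norm_num) using 2 with x
  unfold g; congr 2; ring
lemma G_deriv (x : ℝ) : HasDerivAt (fun x => -2 * G x) (g x) x := by
  unfold G g
  have h : HasDerivAt (fun x : ℝ => -x^2/4) (-x/2) x := by
    have := (hasDerivAt_pow 2 x).neg.div_const 4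
    refine this.congr_deriv ?_
    norm_num; ring
  refine (h.exp.const_mul (-2)).congr_deriv ?_
  ring
lemma G_nonneg (x : ℝ) : 0 ≤ G x := (Real.exp_pos _).le

lemma G_tend (z : ℝ) : Tendsto (fun t => G (z + t)) atTop (nhds 0) := by
  unfold G
  apply Real.tendsto_exp_atBot.comp
  have : Tendsto (fun t : ℝ => (z+t)^2/4) atTop atTop :=
    ((tendsto_pow_atTop (by norm_num)).comp (tendsto_atTop_add_const_left _ z tendsto_id)).atTop_div_const (by norm_num)
  refine (tendsto_neg_atTop_atBot.comp this).congr ?_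
  intro x
  simp [neg_div]

lemma G_hat (k : ℝ) : ∫ x : ℝ, Complex.exp (-Complex.I * (k:ℂ) * (x:ℂ)) * (G x : ℂ) =
    ((2 * Real.sqrt π : ℝ) : ℂ) * Complex.exp (-(k:ℂ)^2) := by
  have h := fourierIntegral_gaussian (b := 1/4) (by norm_num) (-(k:ℂ))
  have e : (π / (1/4) : ℂ) ^ (1/2 : ℂ) = ((2 * Real.sqrt π : ℝ) : ℂ) := by
    have h1 : (π / (1/4) : ℂ) = ((4 * π : ℝ) : ℂ) := by push_cast; ring
    have h2 : (1/2 : ℂ) = ((1/2 : ℝ) : ℂ) := by push_cast; rfl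
    rw [h1, h2, ← Complex.ofReal_cpow (by positivity), ← Real.sqrt_eq_rpow,
      Real.sqrt_mul (by norm_num), show (4:ℝ) = 2^2 by norm_num, Real.sqrt_sq (by norm_num)]
  rw [e] at h
  convert h using 2
  · ext x
    unfold G
    push_cast
    congr 2 <;> ring
  · congr 1; ring

lemma g_hat (k : ℝ) : ∫ x : ℝ, Complex.exp (-Complex.I * (k:ℂ) * (x:ℂ)) * (g x : ℂ) =
    -Complex.I * 2 * k * ((2 * Real.sqrt π : ℝ) : ℂ) * Complex.exp (-(k:ℂ)^2) := by
  have hi := (phase_int k G_int)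
  have h := integral_mul_deriv_eq_deriv_mul_of_integrable
    (u := fun x : ℝ => Complex.exp (-Complex.I * (k:ℂ) * (x:ℂ)))
    (u' := fun x : ℝ => Complex.exp (-Complex.I * (k:ℂ) * (x:ℂ)) * (-Complex.I * (k:ℂ)))
    (v := fun x : ℝ => ((-2 * G x : ℝ) : ℂ)) (v' := fun x => (g x : ℂ))
    (fun x _ => by
      have h1 : HasDerivAt (fun x : ℝ => -Complex.I * (k:ℂ) * (x:ℂ)) (-Complex.I * (k:ℂ)) x := by
        simpa using (Complex.ofRealCLM.hasDerivAt (x := x)).const_mul (-Complex.I * (k:ℂ))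
      exact h1.cexp)
    (fun x _ => (G_deriv x).ofReal_comp) (phase_int k g_int)
    (by
      convert hi.const_mul (2 * Complex.I * k) using 1
      ext x; simp; ring)
    (by
      convert hi.const_mul (-2) using 1
      ext x; simp; ring)
  rw [h]
  have : (∫ x : ℝ, Complex.exp (-Complex.I * (k:ℂ) * (x:ℂ)) * (-Complex.I * (k:ℂ)) * ((-2 * G x : ℝ) : ℂ))
    = (2 * Complex.I * k) * ∫ x : ℝ, Complex.exp (-Complex.I * (k:ℂ) * (x:ℂ)) * (G x : ℂ) := by
    rw [← integral_const_mul]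
    congr 1; ext x; push_cast; ring
  rw [this, G_hat]
  ring

lemma gt_intOn {a T : ℝ} (ha1 : a < 1) (hT : 0 < T) (z : ℝ) :
    IntegrableOn (fun t => g (z + t) * t ^ (a - 1)) (Set.Ioi T) := by
  have h1 : IntegrableOn (fun t => g (z + t)) (Set.Ioi T) := (g_int.comp_add_left z).integrableOn
  have h2 : IntegrableOn (fun t => t ^ (a - 1) * g (z + t)) (Set.Ioi T) := by
    apply Integrable.bdd_mul (c := T ^ (a-1)) h1
    · exact (measurable_id.pow_const (a-1)).aestronglyMeasurable
    · filter_upwards [ae_restrict_mem measurableSet_Ioi] with t ht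
      have ht : T < t := ht
      rw [Real.norm_of_nonneg (Real.rpow_nonneg (hT.trans ht).le _)]
      exact Real.rpow_le_rpow_of_nonpos hT ht.le (by linarith)
  simpa only [mul_comm] using h2

lemma gt_intOn0 {a T : ℝ} (ha0 : 0 < a) (hT : 0 < T) (z : ℝ) :
    IntegrableOn (fun t => g (z + t) * t ^ (a - 1)) (Set.Ioc 0 T) := by
  have h := intervalIntegral.intervalIntegrable_rpow' (a := 0) (b := T) (r := a - 1) (by linarith)
  have h2 := h.continuousOn_mul (g := fun t => g (z + t)) (g_cont.comp (continuous_const.add continuous_id)).continuousOn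
  rwa [intervalIntegrable_iff_integrableOn_Ioc_of_le hT.le] at h2

lemma tail {a T : ℝ} (ha1 : a < 1) (hT : 0 < T) (z : ℝ) :
    ∫ t in Set.Ioi T, g (z + t) * t ^ (a - 1) =
    2 * T ^ (a-1) * G (z + T) + 2 * (a-1) * ∫ t in Set.Ioi T, G (z + t) * t ^ (a - 2) := by
  have hpi : IntegrableOn (fun t : ℝ => t ^ (a - 2)) (Set.Ioi T) :=
    integrableOn_Ioi_rpow_of_lt (by linarith) hT
  have hGi : IntegrableOn (fun t => G (z + t) * t ^ (a - 2)) (Set.Ioi T) := by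
    apply Integrable.bdd_mul (c := 1) hpi
    · exact (G_cont.comp (continuous_const.add continuous_id)).aestronglyMeasurable
    · filter_upwards with t
      rw [Real.norm_of_nonneg (G_nonneg _)]
      exact Real.exp_le_one_iff.2 (by nlinarith [sq_nonneg (z+t)])
  have hcont : ContinuousAt (fun t => t ^ (a-1) * (-2 * G (z+t))) T := by
    apply ContinuousAt.mul
    · exact Real.continuousAt_rpow_const _ _ (Or.inl hT.ne')
    · exact (continuous_const.mul (G_cont.comp (continuous_const.add continuous_id))).continuousAt
  have h := integral_Ioi_mul_deriv_eq_deriv_mul (a := T)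
    (u := fun t => t ^ (a-1)) (u' := fun t => (a-1) * t ^ (a-1-1))
    (v := fun t => -2 * G (z + t)) (v' := fun t => g (z + t))
    (a' := T ^ (a-1) * (-2 * G (z+T))) (b' := 0)
    (fun x hx => Real.hasDerivAt_rpow_const (Or.inl (hT.trans hx).ne'))
    (fun x _ => (G_deriv (z + x)).comp_const_add z x)
    (by
      have := gt_intOn ha1 hT z
      simp only [mul_comm (g _)] at this
      exact this)
    (by
      refine Integrable.congr (hGi.const_mul (-2 * (a - 1))) (Eventually.of_forall fun x => ?_)
      simp only [Pi.mul_apply]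
      rw [show a - 1 - 1 = a - 2 by ring]; ring)
    (hcont.tendsto.mono_left nhdsWithin_le_nhds)
    (by
      have h1 : Tendsto (fun t : ℝ => t ^ (a-1)) atTop (nhds 0) := by
        have := tendsto_rpow_neg_atTop (y := 1 - a) (by linarith)
        simpa using this
      have h2 := h1.mul ((G_tend z).const_mul (-2))
      rw [mul_zero, mul_zero] at h2
      exact h2)
  simp only [mul_comm (g _)]
  rw [h]
  have : (∫ x in Set.Ioi T, (a-1) * x ^ (a-1-1) * (-2 * G (z+x))) =
     (-2 * (a-1)) * ∫ t in Set.Ioi T, G (z + t) * t ^ (a - 2) := by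
    rw [← integral_const_mul]
    congr 1; ext x
    rw [show a - 1 - 1 = a - 2 by ring]; ring
  rw [this]; ring

lemma tail_int {a T : ℝ} (ha1 : a < 1) (hT : 0 < T) :
    Integrable (fun z => ∫ t in Set.Ioi T, g (z + t) * t ^ (a - 1)) := by
  simp_rw [tail ha1 hT]
  apply Integrable.add
  · exact (G_int.comp_add_right T).const_mul _
  · exact (shift_int G_cont G_int _ (integrableOn_Ioi_rpow_of_lt (by linarith) hT)).integral_prod_left.const_mul _

lemma tail_bound {a T : ℝ} (ha1 : a < 1) (hT : 0 < T) :
    ∫ z, |∫ t in Set.Ioi T, g (z + t) * t ^ (a - 1)| ≤ 4 * (∫ x, |G x|) * T ^ (a-1) := by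
  have hpi : IntegrableOn (fun t : ℝ => t ^ (a - 2)) (Set.Ioi T) :=
    integrableOn_Ioi_rpow_of_lt (by linarith) hT
  have i1 : Integrable (fun z => 2 * T ^ (a-1) * |G (z + T)|) :=
    (G_int.comp_add_right T).abs.const_mul _
  have i2 : Integrable (fun z => 2 * (1-a) * |∫ t in Set.Ioi T, G (z + t) * t ^ (a - 2)|) :=
    (shift_int G_cont G_int _ hpi).integral_prod_left.abs.const_mul _
  have hb := L1_bound G_cont G_int _ hpi
  have hp : ∫ t in Set.Ioi T, |t ^ (a-2)| = T ^ (a-1) / (1 - a) := by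
    have : ∫ t in Set.Ioi T, |t ^ (a-2)| = ∫ t in Set.Ioi T, t ^ (a-2) := by
      apply setIntegral_congr_fun measurableSet_Ioi
      intro t ht
      exact abs_of_nonneg (Real.rpow_nonneg (hT.trans ht).le _)
    rw [this, integral_Ioi_rpow_of_lt (by linarith) hT, show a - 2 + 1 = a - 1 by ring,
      show a - 1 = -(1 - a) by ring, neg_div_neg_eq]
  rw [hp] at hb
  have ha : 0 < 1 - a := by linarith
  have hTp : 0 < T ^ (a-1) := Real.rpow_pos_of_pos hT _
  calc _ ≤ ∫ z, (2 * T ^ (a-1) * |G (z + T)| +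
        2 * (1-a) * |∫ t in Set.Ioi T, G (z + t) * t ^ (a - 2)|) := by
        apply integral_mono (tail_int ha1 hT).abs (i1.add i2)
        intro z
        simp only [Pi.add_apply]
        rw [tail ha1 hT]
        refine (abs_add_le _ _).trans ?_
        rw [abs_mul, abs_mul (2 * (a-1)), abs_of_pos (by positivity : 0 < 2 * T ^ (a-1)),
          abs_of_neg (by linarith : 2 * (a-1) < 0)]
        apply le_of_eq; ring
    _ = 2 * T ^ (a-1) * (∫ x, |G x|) +
        2 * (1-a) * ∫ z, |∫ t in Set.Ioi T, G (z + t) * t ^ (a - 2)| := by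
        rw [integral_add i1 i2, integral_const_mul, integral_const_mul,
          integral_add_right_eq_self (fun x => |G x|)]
    _ ≤ 2 * T ^ (a-1) * (∫ x, |G x|) +
        2 * (1-a) * ((∫ x, |G x|) * (T ^ (a-1) / (1 - a))) := by gcongr
    _ = _ := by field_simp; ring

lemma main (a : ℝ) (ha0 : 0 < a) (ha1 : a < 1) (k : ℝ) (hk : 0 < k) (J : ℂ)
    (hJ : Tendsto (fun z : ℝ =>
        ∫ s in (0:ℝ)..z, Complex.exp (2 * Complex.I * (s:ℂ)) * ((s ^ (a - 1) : ℝ) : ℂ))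
      atTop (nhds J)) (f : ℝ → ℝ)
    (hf : ∀ z, f z = ∫ t in Set.Ioi 0, g (z + t) * t ^ (a - 1)) :
    (∫ z : ℝ, Complex.exp (-Complex.I * (k:ℂ) * (z:ℂ)) * (f z : ℂ)) =
      -Complex.I * (((2:ℝ) ^ (1 + a) : ℝ) : ℂ) * ((2 * Real.sqrt π : ℝ) : ℂ)
        * ((k ^ (1 - a) : ℝ) : ℂ) * Complex.exp (-(k:ℂ)^2) * J := by
  have hpi (T : ℝ) (hT : 0 < T) : IntegrableOn (fun t : ℝ => t ^ (a - 1)) (Set.Ioc 0 T) := by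
    rw [← intervalIntegrable_iff_integrableOn_Ioc_of_le hT.le]
    exact intervalIntegral.intervalIntegrable_rpow' (by linarith)
  have hsplit (T : ℝ) (hT : 0 < T) (z : ℝ) : f z =
      (∫ t in Set.Ioc 0 T, g (z + t) * t ^ (a - 1)) + ∫ t in Set.Ioi T, g (z + t) * t ^ (a - 1) := by
    rw [hf, ← setIntegral_union (Set.Ioc_disjoint_Ioi le_rfl) measurableSet_Ioi
      (gt_intOn0 ha0 hT z) (gt_intOn ha1 hT z), Set.Ioc_union_Ioi_eq_Ioi hT.le]
  set A : ℂ := -Complex.I * 2 * k * ((2 * Real.sqrt π : ℝ) : ℂ) * Complex.exp (-(k:ℂ)^2) with hA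
  set c : ℝ := (k/2) ^ (-a) with hc
  set Jz : ℝ → ℂ := fun z => ∫ s in (0:ℝ)..z,
    Complex.exp (2 * Complex.I * (s:ℂ)) * ((s ^ (a - 1) : ℝ) : ℂ) with hJz
  have hscale (T : ℝ) (hT : 0 < T) :
      ∫ t in Set.Ioc 0 T, Complex.exp (Complex.I * (k:ℂ) * (t:ℂ)) * ((t ^ (a-1) : ℝ) : ℂ)
        = c * Jz (k/2 * T) := by
    have hk2 : 0 < k / 2 := by positivity
    have h := intervalIntegral.smul_integral_comp_mul_left (a := 0) (b := T)
      (fun s : ℝ => Complex.exp (2 * Complex.I * (s:ℂ)) * ((s ^ (a - 1) : ℝ) : ℂ)) (k/2)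
    rw [mul_zero] at h
    rw [hJz]; simp only
    rw [← h, ← intervalIntegral.integral_of_le hT.le, Complex.real_smul, ← mul_assoc,
      ← intervalIntegral.integral_const_mul]
    apply intervalIntegral.integral_congr
    intro t ht
    rw [Set.uIcc_of_le hT.le] at ht
    simp only
    rw [Real.mul_rpow hk2.le ht.1]
    have e1 : c * (k/2) * (k/2)^(a-1) = 1 := by
      rw [hc, ← Real.rpow_add_one hk2.ne', ← Real.rpow_add hk2]
      norm_num
    have e1' : (c:ℂ) * ((k/2 : ℝ) : ℂ) * (((k/2)^(a-1) : ℝ) : ℂ) = 1 := by exact_mod_cast e1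
    have e2 : 2 * Complex.I * ((k/2 * t : ℝ) : ℂ) = Complex.I * k * t := by push_cast; ring
    rw [e2, Complex.ofReal_mul]
    linear_combination (-Complex.exp (Complex.I * k * t) * ((t ^ (a-1) : ℝ) : ℂ)) * e1'
  have hbound (T : ℝ) (hT : 0 < T) :
      ‖(∫ z : ℝ, Complex.exp (-Complex.I * (k:ℂ) * (z:ℂ)) * (f z : ℂ)) - A * (c * Jz (k/2 * T))‖
        ≤ 4 * (∫ x, |G x|) * T ^ (a-1) := by
    have i1 := phase_int k (shift_int g_cont g_int _ (hpi T hT)).integral_prod_left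
    have i2 := phase_int k (tail_int ha1 hT)
    have e1 := phase_conv k g_cont g_int _ (hpi T hT)
    rw [g_hat, hscale T hT] at e1
    simp only [hsplit T hT, Complex.ofReal_add, mul_add]
    rw [integral_add i1 i2, e1, add_sub_cancel_left]
    refine (norm_integral_le_integral_norm _).trans ?_
    simp only [norm_mul, phase_norm, one_mul, Complex.norm_real, Real.norm_eq_abs]
    exact tail_bound ha1 hT
  have hlim0 : Tendsto (fun T : ℝ => 4 * (∫ x, |G x|) * T ^ (a-1)) atTop (nhds 0) := by
    have := (tendsto_rpow_neg_atTop (y := 1 - a) (by linarith)).const_mul (4 * (∫ x, |G x|))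
    simpa using this
  have hlim1 : Tendsto (fun T : ℝ => A * (c * Jz (k/2 * T))) atTop
      (nhds (∫ z : ℝ, Complex.exp (-Complex.I * (k:ℂ) * (z:ℂ)) * (f z : ℂ))) := by
    rw [tendsto_iff_norm_sub_tendsto_zero]
    refine squeeze_zero' (Eventually.of_forall fun _ => norm_nonneg _) ?_ hlim0
    filter_upwards [eventually_gt_atTop 0] with T hT
    rw [norm_sub_rev]
    exact hbound T hT
  have hlim2 : Tendsto (fun T : ℝ => A * (c * Jz (k/2 * T))) atTop (nhds (A * (c * J))) :=
    ((hJ.comp (tendsto_id.const_mul_atTop (by positivity : 0 < k/2))).const_mul _).const_mul _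
  rw [tendsto_nhds_unique hlim1 hlim2]
  have e : 2 * k * c = 2 ^ (1 + a) * k ^ (1 - a) := by
    rw [hc, Real.div_rpow hk.le (by norm_num), Real.rpow_neg (by norm_num : (0:ℝ) ≤ 2),
      Real.rpow_add (by norm_num), Real.rpow_sub hk, Real.rpow_neg hk.le]
    simp; field_simp
  have e' : (2:ℂ) * k * c = (((2:ℝ) ^ (1 + a) : ℝ) : ℂ) * ((k ^ (1 - a) : ℝ) : ℂ) := by
    exact_mod_cast e
  rw [hA]
  linear_combination (-Complex.I * ((2 * Real.sqrt π : ℝ) : ℂ) * Complex.exp (-(k:ℂ)^2) * J) * e'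

end S19

/-- with `a = 2^{-n}`, for every `k > 0`, the Fourier transform of `f_n`
satisfies `∫ e^{-ikz} f_n(z) dz = −i 2^{1+a} · 2√π · k^{1-a} e^{-k²} J_{n,∞}`, where
`J_{n,∞} = lim_{z→∞} ∫_0^z e^{2is} s^{a-1} ds`. -/
theorem stmt_19 (n : ℕ) (hn : 1 ≤ n) (k : ℝ) (hk : 0 < k) (J : ℂ)
    (hJ : Tendsto (fun z : ℝ =>
        ∫ s in (0:ℝ)..z,
          Complex.exp (2 * Complex.I * (s:ℂ)) * ((s ^ ((2:ℝ)^(-(n:ℝ)) - 1) : ℝ) : ℂ))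
      atTop (nhds J)) :
    (∫ z : ℝ, Complex.exp (-Complex.I * (k:ℂ) * (z:ℂ)) * (fn n z : ℂ)) =
      -Complex.I * (((2:ℝ) ^ (1 + (2:ℝ)^(-(n:ℝ))) : ℝ) : ℂ) * ((2 * Real.sqrt π : ℝ) : ℂ)
        * ((k ^ (1 - (2:ℝ)^(-(n:ℝ))) : ℝ) : ℂ) * Complex.exp (-(k:ℂ)^2) * J := by
  have ha0 : 0 < (2:ℝ)^(-(n:ℝ)) := by positivity
  have ha1 : (2:ℝ)^(-(n:ℝ)) < 1 := by
    apply Real.rpow_lt_one_of_one_lt_of_neg (by norm_num)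
    have : (1:ℝ) ≤ n := by exact_mod_cast hn
    linarith
  refine S19.main _ ha0 ha1 k hk J hJ (fn n) ?_
  intro z
  have h := (measurePreserving_add_left (volume : Measure ℝ) z).setIntegral_preimage_emb
    (measurableEmbedding_addLeft z)
    (fun ξ => ξ * Real.exp (-ξ^2/4) * (ξ - z) ^ ((2:ℝ)^(-(n:ℝ)) - 1)) (Set.Ioi z)
  unfold fn
  rw [← h]
  simp [S19.g]
end
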